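/- arXiv:1110.5625 — 2 statements merged into one kernel-verified Lean document; each statement's English description precedes it below -/
import Mathlib

section
/- For a k-linear, Hom-finite, essentially small, idempotent complete triangulated category C over a commutative artinian ring k, the following are equivalent: (1) C admits a Serre functor S : C ≃ C; (2) C is a dualising k-variety; (3) C has right determined morphisms. -/
open CategoryTheory CategoryTheory.Limits Opposite

universe v u

/-- `α'` factors through `α` (both morphisms ending at the same object). -/
def FactorsThru {C : Type*} [Category C] {X' X Y : C} (α' : X' ⟶ Y) (α : X ⟶ Y) : Prop :=
  ∃ φ : X' ⟶ X, φ ≫ α = α'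

/-- A morphism `α : X ⟶ Y` is right determined by an object `c` if for every morphism
`α' : X' ⟶ Y`, `α'` factors through `α` iff for every `φ : c ⟶ X'` the composite
`φ ≫ α'` factors through `α`. -/
def RightDetermined {C : Type*} [Category C] {X Y : C} (α : X ⟶ Y) (c : C) : Prop :=
  ∀ ⦃X' : C⦄ (α' : X' ⟶ Y),
    FactorsThru α' α ↔ ∀ φ : c ⟶ X', FactorsThru (φ ≫ α') α

/-- A morphism is left determined by `c` if it is right determined by `c` as a morphism
of the opposite category. -/
def LeftDetermined {C : Type*} [Category C] {X Y : C} (α : X ⟶ Y) (c : C) : Prop :=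
  RightDetermined α.op (op c)

/-- `α : X ⟶ Y` is right minimal if every `φ : X ⟶ X` with `φ ≫ α = α` is an isomorphism. -/
def RightMinimal {C : Type*} [Category C] {X Y : C} (α : X ⟶ Y) : Prop :=
  ∀ φ : X ⟶ X, φ ≫ α = α → IsIso φ

/-- The image of the induced map `Hom(c, X) → Hom(c, Y)`, as a subset of `Hom(c, Y)`. -/
def ImHom {C : Type*} [Category C] (c : C) {X Y : C} (α : X ⟶ Y) : Set (c ⟶ Y) :=
  {g : c ⟶ Y | ∃ f : c ⟶ X, f ≫ α = g}

/-- The left action of `(End c)ᵐᵒᵖ` on `c ⟶ X` given by precomposition; this encodes the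
structure of `Hom(c, X)` as a module over `Γ = End c` acting by precomposition. -/
instance endOpModule {C : Type*} [Category C] [Preadditive C] (c X : C) :
    Module (End c)ᵐᵒᵖ (c ⟶ X) where
  smul γ f := γ.unop ≫ f
  one_smul f := Category.id_comp f
  mul_smul γ₁ γ₂ f := by
    show ((γ₁ * γ₂).unop) ≫ f = γ₁.unop ≫ (γ₂.unop ≫ f)
    rw [MulOpposite.unop_mul]
    show (γ₁.unop ≫ γ₂.unop) ≫ f = _
    simp
  smul_zero γ := Limits.comp_zero
  smul_add γ f g := Preadditive.comp_add _ _ _ _ _ _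
  add_smul γ₁ γ₂ f := Preadditive.add_comp _ _ _ _ _ _
  zero_smul f := Limits.zero_comp

theorem endOpModule_smul_def {C : Type*} [Category C] [Preadditive C] {c X : C}
    (γ : (End c)ᵐᵒᵖ) (f : c ⟶ X) : γ • f = γ.unop ≫ f := rfl
/-- `E` is an injective envelope of `k/𝔯` over `k`, where `𝔯` is the Jacobson radical of `k`:
`E` is an injective `k`-module and there is an injective `k`-linear map
`k/𝔯 →ₗ[k] E` whose image is an essential submodule of `E`. -/
def IsInjectiveEnvelopeOfResidueField (k : Type v) [CommRing k]
    (E : Type v) [AddCommGroup E] [Module k E] : Prop :=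
  Module.Injective k E ∧
    ∃ i : (k ⧸ (⊥ : Ideal k).jacobson) →ₗ[k] E,
      Function.Injective i ∧
      ∀ N : Submodule k E, N ≠ ⊥ → N ⊓ LinearMap.range i ≠ ⊥
section Serre

variable (k : Type v) [CommRing k] (E : Type v) [AddCommGroup E] [Module k E]
variable {C : Type u} [Category.{v} C] [Preadditive C] [Linear k C]

/-- `S` is a right Serre functor: there are `k`-linear isomorphisms
`D Hom_C(X, Y) = Hom_k(Hom_C(X, Y), E) ≅ Hom_C(Y, S X)`, natural in both variables. -/
def IsRightSerreFunctor (S : C ⥤ C) : Prop :=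
  S.Additive ∧
  ∃ e : ∀ X Y : C, ((X ⟶ Y) →ₗ[k] E) ≃ₗ[k] (Y ⟶ S.obj X),
    (∀ ⦃X Y' Y : C⦄ (f : Y' ⟶ Y) (ψ : (X ⟶ Y) →ₗ[k] E),
      e X Y' (ψ.comp (Linear.rightComp k X f)) = f ≫ e X Y ψ) ∧
    (∀ ⦃X X' Y : C⦄ (u : X ⟶ X') (ψ : (X ⟶ Y) →ₗ[k] E),
      e X' Y (ψ.comp (Linear.leftComp k Y u)) = e X Y ψ ≫ S.map u)

variable (C) in
/-- `C` admits a right Serre functor. -/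
def HasRightSerreFunctor : Prop :=
  ∃ S : C ⥤ C, IsRightSerreFunctor k E S

variable (C) in
/-- `C` admits a Serre functor, i.e. a right Serre functor which is an equivalence. -/
def HasSerreFunctor : Prop :=
  ∃ S : C ⥤ C, S.IsEquivalence ∧ IsRightSerreFunctor k E S

end Serre
section ModCat

variable (k : Type v) [CommRing k] (E : Type v) [AddCommGroup E] [Module k E]
variable (C : Type u) [Category.{v} C] [Preadditive C] [Linear k C]

/-- A functor `F : Cᵒᵖ ⥤ ModuleCat k` is finitely presented if there is an exact sequence
`Hom_C(−, X) → Hom_C(−, Y) → F → 0`, i.e. `F` is a cokernel of a morphism between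
representable functors.  (`mod C` is the full subcategory of such functors.) -/
def IsFPContra (F : Cᵒᵖ ⥤ ModuleCat.{v} k) : Prop :=
  ∃ (X Y : C) (p : X ⟶ Y), Nonempty (F ≅ Limits.cokernel ((linearYoneda k C).map p))

/-- A functor `G : C ⥤ ModuleCat k` is finitely presented if there is an exact sequence
`Hom_C(Y, −) → Hom_C(X, −) → G → 0`, i.e. `G` is a cokernel of a morphism between
corepresentable functors.  (`mod (Cᵒᵖ)` is the full subcategory of such functors.) -/
def IsFPCov (G : C ⥤ ModuleCat.{v} k) : Prop :=
  ∃ (X Y : C) (p : X ⟶ Y), Nonempty (G ≅ Limits.cokernel ((linearCoyoneda k C).map p.op))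

/-- The duality `D = Hom_k(−, E) : (ModuleCat k)ᵒᵖ ⥤ ModuleCat k`. -/
noncomputable abbrev DModule : (ModuleCat.{v} k)ᵒᵖ ⥤ ModuleCat.{v} k :=
  (linearYoneda k (ModuleCat.{v} k)).obj (ModuleCat.of k E)

/-- The functor `F ↦ D ∘ F` from presheaves to copresheaves. -/
noncomputable def dualizeContra :
    (Cᵒᵖ ⥤ ModuleCat.{v} k)ᵒᵖ ⥤ (C ⥤ ModuleCat.{v} k) :=
  Functor.opHom Cᵒᵖ (ModuleCat.{v} k) ⋙
    (Functor.whiskeringLeft C Cᵒᵖᵒᵖ (ModuleCat.{v} k)ᵒᵖ).obj (opOp C) ⋙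
    (Functor.whiskeringRight C (ModuleCat.{v} k)ᵒᵖ (ModuleCat.{v} k)).obj (DModule k E)

/-- The functor `G ↦ D ∘ G` from copresheaves to presheaves. -/
noncomputable def dualizeCov :
    (C ⥤ ModuleCat.{v} k)ᵒᵖ ⥤ (Cᵒᵖ ⥤ ModuleCat.{v} k) :=
  Functor.opHom C (ModuleCat.{v} k) ⋙
    (Functor.whiskeringRight Cᵒᵖ (ModuleCat.{v} k)ᵒᵖ (ModuleCat.{v} k)).obj (DModule k E)

/-- `C` is a dualising `k`-variety: `F ↦ D ∘ F` sends finitely presented presheaves to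
finitely presented copresheaves and the induced functor `(mod C)ᵒᵖ ⥤ mod (Cᵒᵖ)` is an
equivalence of categories. -/
noncomputable def IsDualisingVariety : Prop :=
  ∃ h : ∀ F : ObjectProperty.FullSubcategory (IsFPContra k C),
      IsFPCov k C ((dualizeContra k E C).obj (op F.obj)),
    (ObjectProperty.lift (IsFPCov k C)
      ((ObjectProperty.ι (IsFPContra k C)).op ⋙ dualizeContra k E C)
      (fun F => h F.unop)).IsEquivalence

end ModCat
/-- `C` has right determined morphisms (Definition `de:det`): for every object `Y`,
(1) for every object `c` and every `End_C(c)`-submodule `H ⊆ Hom_C(c, Y)` (acting by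
precomposition) there exists a right `c`-determined morphism `α : X ⟶ Y` with
`Im Hom_C(c, α) = H`; (2) every morphism ending in `Y` is right determined by some object. -/
def HasRightDeterminedMorphisms (C : Type u) [Category.{v} C] [Preadditive C] : Prop :=
  (∀ (c Y : C) (H : Submodule (End c)ᵐᵒᵖ (c ⟶ Y)),
    ∃ (X : C) (α : X ⟶ Y), RightDetermined α c ∧ ImHom c α = (H : Set (c ⟶ Y))) ∧
  (∀ ⦃X Y : C⦄ (α : X ⟶ Y), ∃ c : C, RightDetermined α c)

theorem isSemisimpleModule_quotient_jacobson (k : Type*) [CommRing k] [IsArtinianRing k] :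
    IsSemisimpleModule k (k ⧸ (⊥ : Ideal k).jacobson) := by
  rw [IsArtinian.isSemisimpleModule_iff_jacobson, Ideal.jacobson_bot]
  exact Module.jacobson_quotient_jacobson k k

theorem isReduced_quotient_jacobson (k : Type*) [CommRing k] [IsArtinianRing k] :
    IsReduced (k ⧸ (⊥ : Ideal k).jacobson) := by
  rw [← Ideal.isRadical_iff_quotient_reduced, IsArtinianRing.jacobson_eq_radical]
  exact Ideal.radical_isRadical _

theorem IsInjectiveEnvelopeOfResidueField.apply_mem_range_of_isSimpleModule
    {k : Type v} [CommRing k] {E : Type v} [AddCommGroup E] [Module k E]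
    {M : Type v} [AddCommGroup M] [Module k M] [IsSimpleModule k M]
    {i : (k ⧸ (⊥ : Ideal k).jacobson) →ₗ[k] E}
    (hess : ∀ N : Submodule k E, N ≠ ⊥ → N ⊓ LinearMap.range i ≠ ⊥)
    (f : M →ₗ[k] E) (s : M) : f s ∈ LinearMap.range i := by
  by_cases hf : LinearMap.range f = ⊥
  · rw [LinearMap.range_eq_bot] at hf
    simp [hf]
  · obtain ⟨x, ⟨⟨s', rfl⟩, hx⟩, hx0⟩ := (Submodule.ne_bot_iff _).1 (hess _ hf)
    have hs' : s' ≠ 0 := by rintro rfl; simp at hx0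
    obtain ⟨r, rfl⟩ := IsSimpleModule.toSpanSingleton_surjective k hs' s
    simpa using Submodule.smul_mem _ r hx

section MatlisDuality

variable {k : Type v} [CommRing k] [IsArtinianRing k] {E : Type v} [AddCommGroup E] [Module k E]

/-- The injective envelope of `k/𝔯` is a cogenerator. -/
theorem IsInjectiveEnvelopeOfResidueField.exists_apply_ne_zero
    (hE : IsInjectiveEnvelopeOfResidueField k E) {M : Type v} [AddCommGroup M] [Module k M]
    {m : M} (hm : m ≠ 0) : ∃ ψ : M →ₗ[k] E, ψ m ≠ 0 := by
  obtain ⟨hinj, i, hi, -⟩ := hE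
  have hs := isSemisimpleModule_quotient_jacobson k
  let f := LinearMap.toSpanSingleton k M m
  have hker : LinearMap.ker f ≠ ⊤ := by
    intro h
    have h1 : (1 : k) ∈ LinearMap.ker f := h ▸ Submodule.mem_top
    exact hm (by simpa [f] using h1)
  obtain ⟨I, hI, hle⟩ := Ideal.exists_le_maximal _ hker
  have hr : (⊥ : Ideal k).jacobson ≤ I := sInf_le ⟨bot_le, hI⟩
  obtain ⟨s, hs'⟩ := IsSemisimpleModule.lifting_property (Submodule.factor hr)
    (Submodule.factor_surjective hr) (LinearMap.id : (k ⧸ I) →ₗ[k] (k ⧸ I))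
  have hsinj : Function.Injective s := by
    have : Function.LeftInverse (Submodule.factor hr) s := fun x => LinearMap.congr_fun hs' x
    exact this.injective
  let g : (k ⧸ LinearMap.ker f) →ₗ[k] E := i ∘ₗ s ∘ₗ Submodule.factor hle
  let j : (k ⧸ LinearMap.ker f) →ₗ[k] M := (LinearMap.ker f).liftQ f le_rfl
  have hj : Function.Injective j := by
    rw [← LinearMap.ker_eq_bot]; exact Submodule.ker_liftQ_eq_bot _ _ _ le_rfl
  obtain ⟨ψ, hψ⟩ := hinj.out j hj g
  refine ⟨ψ, fun h => ?_⟩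
  have h1 := hψ (Submodule.Quotient.mk 1)
  have h2 : j (Submodule.Quotient.mk 1) = m := by
    change f 1 = m
    simp [f]
  rw [h2, h] at h1
  have h3 : g (Submodule.Quotient.mk 1) = i (s (Submodule.Quotient.mk 1)) := rfl
  rw [h3] at h1
  have h4 : s (Submodule.Quotient.mk 1) = 0 := hi (by rw [← h1, map_zero])
  have h5 : (Submodule.Quotient.mk 1 : k ⧸ I) = 0 := hsinj (by rw [h4, map_zero])
  rw [Submodule.Quotient.mk_eq_zero] at h5
  exact hI.ne_top ((Ideal.eq_top_iff_one I).2 h5)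

theorem IsInjectiveEnvelopeOfResidueField.eq_zero_of_forall
    (hE : IsInjectiveEnvelopeOfResidueField k E) {M : Type v} [AddCommGroup M] [Module k M]
    {m : M} (hm : ∀ ψ : M →ₗ[k] E, ψ m = 0) : m = 0 := by
  by_contra h
  obtain ⟨ψ, hψ⟩ := hE.exists_apply_ne_zero h
  exact hψ (hm ψ)

theorem IsInjectiveEnvelopeOfResidueField.length_dual_le_one
    (hE : IsInjectiveEnvelopeOfResidueField k E) {M : Type v} [AddCommGroup M] [Module k M]
    [IsSimpleModule k M] : Module.length k (M →ₗ[k] E) ≤ 1 := by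
  obtain ⟨-, i, hi, hess⟩ := hE
  have hred := isReduced_quotient_jacobson k
  rcases subsingleton_or_nontrivial (M →ₗ[k] E) with h | h
  · simp
  have : IsSimpleModule k (M →ₗ[k] E) := by
    refine isSimpleModule_iff_toSpanSingleton_surjective.2 ⟨h, fun f hf g => ?_⟩
    obtain ⟨s, hs⟩ : ∃ s, f s ≠ 0 := by
      by_contra! hcon
      exact hf (LinearMap.ext hcon)
    obtain ⟨x, hx⟩ := apply_mem_range_of_isSimpleModule hess f s
    obtain ⟨y, hy⟩ := apply_mem_range_of_isSimpleModule hess g s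
    obtain ⟨a, rfl⟩ := Ideal.Quotient.mk_surjective x
    obtain ⟨c, rfl⟩ := Ideal.Quotient.mk_surjective y
    have has : a • s ≠ 0 := by
      intro h0
      have h1 : i (a • Ideal.Quotient.mk _ a) = 0 := by
        rw [map_smul, hx, ← map_smul, h0, map_zero]
      have h2 : Ideal.Quotient.mk (⊥ : Ideal k).jacobson a * Ideal.Quotient.mk _ a = 0 :=
        hi (by rw [map_zero]; exact h1)
      have h3 : Ideal.Quotient.mk (⊥ : Ideal k).jacobson a = 0 :=
        IsReduced.eq_zero _ ⟨2, by rw [pow_two, h2]⟩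
      exact hs (by rw [← hx, h3, map_zero])
    obtain ⟨b, hb⟩ := IsSimpleModule.toSpanSingleton_surjective k has s
    have hb' : b • a • s = s := hb
    have hcomm : a • Ideal.Quotient.mk (⊥ : Ideal k).jacobson c = c • Ideal.Quotient.mk _ a := by
      change Ideal.Quotient.mk (⊥ : Ideal k).jacobson a * Ideal.Quotient.mk _ c =
        Ideal.Quotient.mk _ c * Ideal.Quotient.mk _ a
      exact mul_comm _ _
    refine ⟨b * c, LinearMap.ext fun t => ?_⟩
    have hs0 : s ≠ 0 := by rintro rfl; simp at hs
    obtain ⟨r, rfl⟩ := IsSimpleModule.toSpanSingleton_surjective k hs0 t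
    have key : (b * c) • f s = g s := by
      rw [← hx, mul_smul, ← map_smul, ← hcomm, map_smul, hy, ← map_smul, ← map_smul, hb']
    simp only [LinearMap.toSpanSingleton_apply, LinearMap.smul_apply, map_smul]
    rw [key]
  rw [Module.length_eq_one]

theorem IsInjectiveEnvelopeOfResidueField.length_dual_le
    (hE : IsInjectiveEnvelopeOfResidueField k E) {M : Type v} [AddCommGroup M] [Module k M]
    (hM : IsFiniteLength k M) : Module.length k (M →ₗ[k] E) ≤ Module.length k M := by
  induction hM with
  | of_subsingleton => simp
  | @of_simple_quotient M _ _ N _ _ ih =>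
    let f : ((M ⧸ N) →ₗ[k] E) →ₗ[k] (M →ₗ[k] E) := LinearMap.lcomp k E N.mkQ
    let g : (M →ₗ[k] E) →ₗ[k] (N →ₗ[k] E) := LinearMap.lcomp k E N.subtype
    have hf : Function.Injective f := by
      intro a b hab
      exact Submodule.linearMap_qext _ hab
    have hex : Function.Exact f g.rangeRestrict := by
      intro ψ
      constructor
      · intro h
        have h' : ψ ∘ₗ N.subtype = 0 := congrArg Subtype.val h
        have hle : N ≤ LinearMap.ker ψ := fun x hx => LinearMap.congr_fun h' ⟨x, hx⟩
        exact ⟨N.liftQ ψ hle, N.liftQ_mkQ ψ hle⟩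
      · rintro ⟨χ, rfl⟩
        apply Subtype.ext
        ext x
        change χ (N.mkQ x) = 0
        rw [Submodule.mkQ_apply, (Submodule.Quotient.mk_eq_zero N).2 x.2, map_zero]
    rw [Module.length_eq_add_of_exact f g.rangeRestrict hf g.surjective_rangeRestrict hex,
      Module.length_eq_add_of_exact N.subtype N.mkQ N.subtype_injective N.mkQ_surjective
        (LinearMap.exact_subtype_mkQ N), add_comm, Module.length_eq_one (R := k) (M := M ⧸ N)]
    gcongr
    · exact (Module.length_le_of_injective _ (Submodule.subtype_injective _)).trans ih
    · exact hE.length_dual_le_one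

theorem IsInjectiveEnvelopeOfResidueField.isFiniteLength_dual
    (hE : IsInjectiveEnvelopeOfResidueField k E) {M : Type v} [AddCommGroup M] [Module k M]
    (hM : IsFiniteLength k M) : IsFiniteLength k (M →ₗ[k] E) := by
  rw [← Module.length_ne_top_iff] at hM ⊢
  exact ((hE.length_dual_le (Module.length_ne_top_iff.1 hM)).trans_lt (lt_top_iff_ne_top.2 hM)).ne

/-- Every functional on the dual of a module of finite length is an evaluation. -/
theorem IsInjectiveEnvelopeOfResidueField.exists_eval_eq
    (hE : IsInjectiveEnvelopeOfResidueField k E) {M : Type v} [AddCommGroup M] [Module k M]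
    (hM : IsFiniteLength k M) (θ : (M →ₗ[k] E) →ₗ[k] E) : ∃ m : M, ∀ ψ, θ ψ = ψ m := by
  let ev : M →ₗ[k] ((M →ₗ[k] E) →ₗ[k] E) := LinearMap.id.flip
  have hev : Function.Injective ev := by
    rw [← LinearMap.ker_eq_bot, LinearMap.ker_eq_bot']
    exact fun m hm => hE.eq_zero_of_forall fun ψ => LinearMap.congr_fun hm ψ
  have hD := hE.isFiniteLength_dual hM
  have hle := (hE.length_dual_le hD).trans (hE.length_dual_le hM)
  have hexact := Module.length_eq_add_of_exact ev (LinearMap.range ev).mkQ hev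
    (Submodule.mkQ_surjective _) (LinearMap.exact_map_mkQ_range ev)
  rw [hexact] at hle
  have hzero : Module.length k (((M →ₗ[k] E) →ₗ[k] E) ⧸ LinearMap.range ev) = 0 := by
    have hfin := Module.length_ne_top_iff.2 hM
    exact nonpos_iff_eq_zero.1 ((ENat.add_le_add_iff_left hfin).1 (by simpa using hle))
  rw [Module.length_eq_zero_iff, Submodule.Quotient.subsingleton_iff] at hzero
  obtain ⟨m, hm⟩ := (hzero ▸ Submodule.mem_top : θ ∈ LinearMap.range ev)
  exact ⟨m, fun ψ => by rw [← hm]; rfl⟩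

/-- Every linear map between duals of modules of finite length is a transpose. -/
theorem IsInjectiveEnvelopeOfResidueField.exists_comp_eq
    (hE : IsInjectiveEnvelopeOfResidueField k E) {M N : Type v} [AddCommGroup M] [Module k M]
    [AddCommGroup N] [Module k N] (hN : IsFiniteLength k N)
    (l : (N →ₗ[k] E) →ₗ[k] (M →ₗ[k] E)) : ∃ μ : M →ₗ[k] N, ∀ ψ, l ψ = ψ ∘ₗ μ := by
  choose μ hμ using fun m : M => hE.exists_eval_eq hN (l.flip m)
  have hinj {a b : N} (h : ∀ ψ : N →ₗ[k] E, ψ a = ψ b) : a = b :=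
    sub_eq_zero.1 (hE.eq_zero_of_forall fun ψ => by rw [map_sub, h, sub_self])
  exact ⟨{ toFun := μ
           map_add' := fun a b => hinj fun ψ => by rw [← hμ, map_add, map_add, ← hμ, ← hμ]; rfl
           map_smul' := fun r a => hinj fun ψ => by
             rw [← hμ, map_smul, RingHom.id_apply, map_smul, ← hμ]; rfl },
    fun ψ => LinearMap.ext fun m => hμ m ψ⟩

/-- If a pairing `M × N → E` identifies `N` with the dual of `M`, then it identifies `M` with the
dual of `N`. -/
theorem IsInjectiveEnvelopeOfResidueField.bijective_flip
    (hE : IsInjectiveEnvelopeOfResidueField k E) {M N : Type v} [AddCommGroup M] [Module k M]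
    [AddCommGroup N] [Module k N] (hM : IsFiniteLength k M) (B : N →ₗ[k] M →ₗ[k] E)
    (hB : Function.Bijective B) : Function.Bijective B.flip := by
  constructor
  · rw [← LinearMap.ker_eq_bot, LinearMap.ker_eq_bot']
    refine fun m hm => hE.eq_zero_of_forall fun ψ => ?_
    obtain ⟨n, rfl⟩ := hB.2 ψ
    exact LinearMap.congr_fun hm n
  · intro θ
    obtain ⟨m, hm⟩ := hE.exists_eval_eq hM (θ ∘ₗ (LinearEquiv.ofBijective B hB).symm.toLinearMap)
    refine ⟨m, LinearMap.ext fun n => ?_⟩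
    have := hm (B n)
    rw [LinearMap.comp_apply] at this
    rw [LinearMap.flip_apply, ← this]
    congr 1
    exact ((LinearEquiv.ofBijective B hB).symm_apply_apply n)

end MatlisDuality

section WeaklyExact

variable {C : Type u} [Category.{v} C] [Preadditive C]

/-- A pair of composable morphisms such that the first is a weak kernel of the second, and the
second is a weak cokernel of the first. -/
structure IsWeaklyExact {X Y Z : C} (f : X ⟶ Y) (g : Y ⟶ Z) : Prop where
  weakKernel : ∀ ⦃T : C⦄ (h : T ⟶ Y), h ≫ g = 0 ↔ FactorsThru h f
  weakCokernel : ∀ ⦃T : C⦄ (h : Y ⟶ T), f ≫ h = 0 ↔ ∃ l : Z ⟶ T, g ≫ l = h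

theorem IsWeaklyExact.comp_eq_zero {X Y Z : C} {f : X ⟶ Y} {g : Y ⟶ Z}
    (h : IsWeaklyExact f g) : f ≫ g = 0 :=
  (h.weakKernel f).2 ⟨𝟙 X, Category.id_comp f⟩

variable [HasZeroObject C] [HasShift C ℤ] [∀ n : ℤ, (shiftFunctor C n).Additive]
  [Pretriangulated C]

theorem isWeaklyExact_of_distinguished (T : Pretriangulated.Triangle C)
    (hT : T ∈ Pretriangulated.distinguishedTriangles) : IsWeaklyExact T.mor₁ T.mor₂ where
  weakKernel Z h := by
    constructor
    · intro hz
      obtain ⟨l, hl⟩ := T.coyoneda_exact₂ hT h hz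
      exact ⟨l, hl.symm⟩
    · rintro ⟨l, rfl⟩
      rw [Category.assoc, Pretriangulated.comp_distTriang_mor_zero₁₂ T hT, comp_zero]
  weakCokernel Z h := by
    constructor
    · intro hz
      obtain ⟨l, hl⟩ := T.yoneda_exact₂ hT h hz
      exact ⟨l, hl.symm⟩
    · rintro ⟨l, rfl⟩
      rw [← Category.assoc, Pretriangulated.comp_distTriang_mor_zero₁₂ T hT, zero_comp]

theorem exists_isWeaklyExact_right {X Y : C} (f : X ⟶ Y) :
    ∃ (Z : C) (g : Y ⟶ Z), IsWeaklyExact f g := by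
  obtain ⟨Z, g, h, hT⟩ := Pretriangulated.distinguished_cocone_triangle f
  exact ⟨Z, g, isWeaklyExact_of_distinguished _ hT⟩

theorem exists_isWeaklyExact_left {Y Z : C} (g : Y ⟶ Z) :
    ∃ (X : C) (f : X ⟶ Y), IsWeaklyExact f g := by
  obtain ⟨X, f, h, hT⟩ := Pretriangulated.distinguished_cocone_triangle₁ g
  exact ⟨X, f, isWeaklyExact_of_distinguished _ hT⟩

end WeaklyExact

theorem Module.Injective.exists_comp_eq {k : Type v} [CommRing k] {E : Type v} [AddCommGroup E]
    [Module k E] (hE : Module.Injective k E) {M N : Type v} [AddCommGroup M] [Module k M]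
    [AddCommGroup N] [Module k N] (φ : M →ₗ[k] N) (t : M →ₗ[k] E)
    (h : LinearMap.ker φ ≤ LinearMap.ker t) : ∃ s : N →ₗ[k] E, s ∘ₗ φ = t := by
  obtain ⟨s, hs⟩ := hE.out ((LinearMap.ker φ).liftQ φ le_rfl)
    (LinearMap.ker_eq_bot.1 (Submodule.ker_liftQ_eq_bot _ _ _ le_rfl))
    ((LinearMap.ker φ).liftQ t h)
  exact ⟨s, LinearMap.ext fun m => hs (Submodule.Quotient.mk m)⟩

section DualHom

variable {k : Type v} [CommRing k] {E : Type v} [AddCommGroup E] [Module k E]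
variable {C : Type u} [Category.{v} C] [Preadditive C] [Linear k C]

/-- The natural map `Hom(Z, W) → D Hom(c, Z)` attached to an element of `D Hom(c, W)`. -/
def dualPullback {c W : C} (t : (c ⟶ W) →ₗ[k] E) (Z : C) :
    (Z ⟶ W) →ₗ[k] (c ⟶ Z) →ₗ[k] E where
  toFun h := t ∘ₗ Linear.rightComp k c h
  map_add' f g := by ext; simp
  map_smul' r f := by ext; simp

@[simp]
theorem dualPullback_apply {c W : C} (t : (c ⟶ W) →ₗ[k] E) {Z : C} (h : Z ⟶ W) (φ : c ⟶ Z) :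
    dualPullback t Z h φ = t (φ ≫ h) := rfl

theorem dualPullback_dualPullback {c W : C} (t : (c ⟶ W) →ₗ[k] E) {Z Z' : C} (h : Z ⟶ W)
    (f : Z' ⟶ Z) : dualPullback (dualPullback t Z h) Z' f = dualPullback t Z' (f ≫ h) := by
  ext; simp

/-- An element of `D Hom(c, W)` is universal if it induces isomorphisms
`Hom(Z, W) ≅ D Hom(c, Z)`. -/
def IsUniversalFunctional {c W : C} (t : (c ⟶ W) →ₗ[k] E) : Prop :=
  ∀ Z : C, Function.Bijective (dualPullback t Z)

/-- The functor `D Hom(c, -)` is cohomological. -/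
theorem IsWeaklyExact.exists_dualPullback_eq (hE : Module.Injective k E) {X Y Z : C} {f : X ⟶ Y}
    {g : Y ⟶ Z} (h : IsWeaklyExact f g) {c : C} (t : (c ⟶ Y) →ₗ[k] E)
    (ht : dualPullback t X f = 0) : ∃ s : (c ⟶ Z) →ₗ[k] E, dualPullback s Y g = t := by
  refine hE.exists_comp_eq (Linear.rightComp k c g) t fun φ hφ => ?_
  obtain ⟨l, rfl⟩ := (h.weakKernel φ).1 hφ
  exact LinearMap.congr_fun ht l

/-- If `D Hom(c, -)` is finitely presented, then it is representable. -/
theorem exists_isUniversalFunctional_of_presentation (hE : Module.Injective k E)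
    [IsIdempotentComplete C] {c X W V : C} {α : X ⟶ W} {β : W ⟶ V} (hαβ : IsWeaklyExact α β)
    (t : (c ⟶ W) →ₗ[k] E) (hgen : ∀ Z, Function.Surjective (dualPullback t Z))
    (hrel : ∀ ⦃Z : C⦄ (h : Z ⟶ W), dualPullback t Z h = 0 ↔ FactorsThru h α) :
    ∃ (R : C) (s : (c ⟶ R) →ₗ[k] E), IsUniversalFunctional s := by
  obtain ⟨z, hz⟩ := hαβ.exists_dualPullback_eq hE t ((hrel α).2 ⟨𝟙 X, Category.id_comp α⟩)
  obtain ⟨f, hf⟩ := hgen V z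
  have ht : dualPullback t W (β ≫ f) = t := by
    rw [← dualPullback_dualPullback, hf, hz]
  have hid : dualPullback t W (𝟙 W) = t := by ext; simp
  obtain ⟨q, hq⟩ := (hrel (β ≫ f - 𝟙 W)).1 (by rw [map_sub, ht, hid, sub_self])
  have hβ : (β ≫ f) ≫ β = β := by
    have : (q ≫ α) ≫ β = 0 := by rw [Category.assoc, hαβ.comp_eq_zero, comp_zero]
    rw [hq, Preadditive.sub_comp, Category.id_comp, sub_eq_zero] at this
    exact this
  have hidem : (β ≫ f) ≫ (β ≫ f) = β ≫ f := by
    rw [← Category.assoc, hβ]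
  obtain ⟨R, i, r, hir, hri⟩ := IsIdempotentComplete.idempotents_split W (β ≫ f) hidem
  refine ⟨R, dualPullback t R i, fun Z => ⟨?_, fun z => ?_⟩⟩
  · rw [← LinearMap.ker_eq_bot, LinearMap.ker_eq_bot']
    intro h hh
    rw [dualPullback_dualPullback] at hh
    have h0 : (h ≫ i) ≫ β = 0 := (hαβ.weakKernel _).2 ((hrel _).1 hh)
    calc h = h ≫ i ≫ (r ≫ i) ≫ r := by simp [hir]
      _ = ((h ≫ i) ≫ β) ≫ f ≫ r := by rw [hri]; simp
      _ = 0 := by rw [h0, zero_comp]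
  · obtain ⟨h, rfl⟩ := hgen Z z
    refine ⟨h ≫ r, ?_⟩
    rw [dualPullback_dualPullback, Category.assoc, hri, ← dualPullback_dualPullback, ht]

theorem exists_generator_of_fg [HasBinaryBiproducts C] {c Z : C}
    (N : Submodule k ((c ⟶ Z) →ₗ[k] E)) (hN : N.FG) :
    ∃ (Y : C) (y : (c ⟶ Y) →ₗ[k] E), ∀ z ∈ N, ∃ h : Z ⟶ Y, dualPullback y Z h = z := by
  induction N, hN using Submodule.fg_induction with
  | singleton x =>
    refine ⟨Z, x, fun z hz => ?_⟩
    obtain ⟨r, rfl⟩ := Submodule.mem_span_singleton.1 hz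
    exact ⟨r • 𝟙 Z, by ext; simp⟩
  | sup N₁ N₂ _ _ h₁ h₂ =>
    obtain ⟨Y₁, y₁, hy₁⟩ := h₁
    obtain ⟨Y₂, y₂, hy₂⟩ := h₂
    refine ⟨Y₁ ⊞ Y₂, dualPullback y₁ _ biprod.fst + dualPullback y₂ _ biprod.snd, fun z hz => ?_⟩
    obtain ⟨z₁, hz₁, z₂, hz₂, rfl⟩ := Submodule.mem_sup.1 hz
    obtain ⟨f₁, rfl⟩ := hy₁ z₁ hz₁
    obtain ⟨f₂, rfl⟩ := hy₂ z₂ hz₂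
    exact ⟨biprod.lift f₁ f₂, by ext; simp⟩

theorem exists_cogenerator_of_fg [HasBinaryBiproducts C] {c Y : C}
    (N : Submodule k ((c ⟶ Y) →ₗ[k] E)) (hN : N.FG) :
    ∃ (c' : C) (y : (c' ⟶ Y) →ₗ[k] E), ∀ ⦃X : C⦄ (α : X ⟶ Y),
      dualPullback y X α = 0 ↔ ∀ ν ∈ N, dualPullback ν X α = 0 := by
  induction N, hN using Submodule.fg_induction with
  | singleton x =>
    refine ⟨c, x, fun X α => ⟨fun h ν hν => ?_, fun h => h x (Submodule.mem_span_singleton_self x)⟩⟩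
    obtain ⟨r, rfl⟩ := Submodule.mem_span_singleton.1 hν
    ext φ
    have : x (φ ≫ α) = 0 := LinearMap.congr_fun h φ
    simp [this]
  | sup N₁ N₂ _ _ h₁ h₂ =>
    obtain ⟨c₁, y₁, hy₁⟩ := h₁
    obtain ⟨c₂, y₂, hy₂⟩ := h₂
    refine ⟨c₁ ⊞ c₂, y₁ ∘ₗ Linear.leftComp k Y biprod.inl + y₂ ∘ₗ Linear.leftComp k Y biprod.inr,
      fun X α => ?_⟩
    trans dualPullback y₁ X α = 0 ∧ dualPullback y₂ X α = 0
    · constructor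
      · intro h
        constructor
        · ext φ
          simpa using LinearMap.congr_fun h (biprod.fst ≫ φ)
        · ext φ
          simpa using LinearMap.congr_fun h (biprod.snd ≫ φ)
      · rintro ⟨h₁, h₂⟩
        ext φ
        have e₁ := LinearMap.congr_fun h₁ (biprod.inl ≫ φ)
        have e₂ := LinearMap.congr_fun h₂ (biprod.inr ≫ φ)
        simp only [dualPullback_apply, Category.assoc, LinearMap.zero_apply] at e₁ e₂
        simp [e₁, e₂]
    · rw [hy₁, hy₂]
      constructor
      · rintro ⟨h₁, h₂⟩ ν hν
        obtain ⟨z₁, hz₁, z₂, hz₂, rfl⟩ := Submodule.mem_sup.1 hν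
        ext φ
        have e₁ : z₁ (φ ≫ α) = 0 := LinearMap.congr_fun (h₁ z₁ hz₁) φ
        have e₂ : z₂ (φ ≫ α) = 0 := LinearMap.congr_fun (h₂ z₂ hz₂) φ
        simp [e₁, e₂]
      · exact fun h => ⟨fun ν hν => h ν (Submodule.mem_sup_left hν),
          fun ν hν => h ν (Submodule.mem_sup_right hν)⟩

end DualHom

section SerreCriterion

variable {k : Type v} [CommRing k] {E : Type v} [AddCommGroup E] [Module k E]
variable {C : Type u} [Category.{v} C] [Preadditive C] [Linear k C]

theorem IsUniversalFunctional.comp_iso {c W W' : C} {t : (c ⟶ W) →ₗ[k] E}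
    (ht : IsUniversalFunctional t) (i : W' ≅ W) :
    IsUniversalFunctional (dualPullback t W' i.hom) := by
  intro Z
  constructor
  · intro a b hab
    rw [dualPullback_dualPullback, dualPullback_dualPullback] at hab
    exact (cancel_mono i.hom).1 ((ht Z).1 hab)
  · intro z
    obtain ⟨h, rfl⟩ := (ht Z).2 z
    exact ⟨h ≫ i.inv, by rw [dualPullback_dualPullback]; simp⟩

theorem IsRightSerreFunctor.exists_isUniversalFunctional {S : C ⥤ C}
    (hS : IsRightSerreFunctor k E S) (c : C) :
    ∃ t : (c ⟶ S.obj c) →ₗ[k] E, IsUniversalFunctional t := by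
  obtain ⟨-, e, he, -⟩ := hS
  refine ⟨(e c (S.obj c)).symm (𝟙 _), fun Z => ?_⟩
  have : ⇑(dualPullback ((e c (S.obj c)).symm (𝟙 _)) Z) = (e c Z).symm := by
    funext h
    rw [LinearEquiv.eq_symm_apply]
    refine (he h _).trans ?_
    rw [LinearEquiv.apply_symm_apply, Category.comp_id]
  rw [this]
  exact (e c Z).symm.bijective

theorem HasSerreFunctor.exists_isUniversalFunctional (h : HasSerreFunctor k E C) (c : C) :
    ∃ (W : C) (t : (c ⟶ W) →ₗ[k] E), IsUniversalFunctional t := by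
  obtain ⟨S, -, hS⟩ := h
  exact ⟨S.obj c, hS.exists_isUniversalFunctional c⟩

theorem HasSerreFunctor.exists_isUniversalFunctional_of_target (h : HasSerreFunctor k E C)
    (Y : C) : ∃ (c : C) (t : (c ⟶ Y) →ₗ[k] E), IsUniversalFunctional t := by
  obtain ⟨S, hS, hS'⟩ := h
  obtain ⟨t, ht⟩ := hS'.exists_isUniversalFunctional (S.objPreimage Y)
  exact ⟨_, _, ht.comp_iso (S.objObjPreimageIso Y).symm⟩

/-- The Serre functor defined by a choice of universal functionals. -/
noncomputable def serreFunctor {W : C → C} {t : ∀ c : C, (c ⟶ W c) →ₗ[k] E}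
    (ht : ∀ c, IsUniversalFunctional (t c)) : C ⥤ C where
  obj := W
  map {X X'} u := Classical.choose ((ht X' (W X)).2 (t X ∘ₗ Linear.leftComp k (W X) u))
  map_id X := by
    apply (ht X _).1
    rw [Classical.choose_spec ((ht X (W X)).2 (t X ∘ₗ Linear.leftComp k (W X) (𝟙 X)))]
    ext; simp
  map_comp {X Y Z} u v := by
    apply (ht Z _).1
    rw [Classical.choose_spec ((ht Z (W X)).2 (t X ∘ₗ Linear.leftComp k (W X) (u ≫ v))),
      ← dualPullback_dualPullback,
      Classical.choose_spec ((ht Z (W Y)).2 (t Y ∘ₗ Linear.leftComp k (W Y) v))]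
    ext φ
    have h := LinearMap.congr_fun
      (Classical.choose_spec ((ht Y (W X)).2 (t X ∘ₗ Linear.leftComp k (W X) u))) (v ≫ φ)
    simpa using h.symm

theorem exists_functor_of_exists_isUniversalFunctional
    (hrep : ∀ c : C, ∃ (W : C) (t : (c ⟶ W) →ₗ[k] E), IsUniversalFunctional t) :
    ∃ (S : C ⥤ C) (t : ∀ c : C, (c ⟶ S.obj c) →ₗ[k] E), (∀ c, IsUniversalFunctional (t c)) ∧
      ∀ ⦃X X' : C⦄ (u : X ⟶ X') (φ : X' ⟶ S.obj X), t X' (φ ≫ S.map u) = t X (u ≫ φ) := by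
  choose W t ht using hrep
  exact ⟨serreFunctor ht, t, ht, fun X X' u φ => LinearMap.congr_fun
    (Classical.choose_spec ((ht X' (W X)).2 (t X ∘ₗ Linear.leftComp k (W X) u))) φ⟩

theorem isRightSerreFunctor_of_isUniversalFunctional {S : C ⥤ C}
    {t : ∀ c : C, (c ⟶ S.obj c) →ₗ[k] E} (ht : ∀ c, IsUniversalFunctional (t c))
    (hmap : ∀ ⦃X X' : C⦄ (u : X ⟶ X') (φ : X' ⟶ S.obj X), t X' (φ ≫ S.map u) = t X (u ≫ φ)) :
    IsRightSerreFunctor k E S := by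
  let e (X Y : C) : (Y ⟶ S.obj X) ≃ₗ[k] ((X ⟶ Y) →ₗ[k] E) :=
    LinearEquiv.ofBijective (dualPullback (t X) Y) (ht X Y)
  have he {X Y : C} (h : Y ⟶ S.obj X) (φ : X ⟶ Y) : e X Y h φ = t X (φ ≫ h) := rfl
  refine ⟨⟨fun {X Y f g} => ?_⟩, fun X Y => (e X Y).symm, ?_, ?_⟩
  · apply (ht Y _).1
    ext φ
    rw [map_add, LinearMap.add_apply, dualPullback_apply, dualPullback_apply, dualPullback_apply,
      hmap, hmap, hmap, Preadditive.add_comp, map_add]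
  · intro X Y' Y f ψ
    obtain ⟨h, rfl⟩ := (e X Y).surjective ψ
    rw [LinearEquiv.symm_apply_eq, LinearEquiv.symm_apply_apply]
    ext φ
    simp [he]
  · intro X X' Y u ψ
    obtain ⟨h, rfl⟩ := (e X Y).surjective ψ
    rw [LinearEquiv.symm_apply_eq, LinearEquiv.symm_apply_apply]
    ext φ
    rw [he, ← Category.assoc, hmap]
    simp [he]

theorem hasSerreFunctor_of_exists_isUniversalFunctional [IsArtinianRing k]
    (hE : IsInjectiveEnvelopeOfResidueField k E)
    [HasZeroObject C] [HasShift C ℤ] [∀ n : ℤ, (shiftFunctor C n).Additive]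
    [Pretriangulated C] [IsIdempotentComplete C]
    (homFinite : ∀ A B : C, IsFiniteLength k (A ⟶ B))
    (hrep : ∀ c : C, ∃ (W : C) (t : (c ⟶ W) →ₗ[k] E), IsUniversalFunctional t)
    (hcog : ∀ Y : C, ∃ (c : C) (t : (c ⟶ Y) →ₗ[k] E), ∀ ⦃X : C⦄ (α : X ⟶ Y),
      dualPullback t X α = 0 → α = 0) : HasSerreFunctor k E C := by
  obtain ⟨S, t, ht, hmap⟩ := exists_functor_of_exists_isUniversalFunctional hrep
  have hflip (X X' : C) : Function.Bijective (dualPullback (t X) X').flip :=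
    hE.bijective_flip (homFinite _ _) _ (ht X X')
  have hfaithful : S.Faithful := ⟨fun {X X' u v} huv => by
    apply (hflip X X').1
    ext φ
    change t X (u ≫ φ) = t X (v ≫ φ)
    rw [← hmap u, ← hmap v, huv]⟩
  have hfull : S.Full := ⟨fun {X X'} g => by
    obtain ⟨u, hu⟩ := (hflip X X').2 (dualPullback (t X') _ g)
    refine ⟨u, (ht X' _).1 ?_⟩
    rw [← hu]
    ext φ
    exact hmap u φ⟩
  have hess : S.EssSurj := ⟨fun Y => by
    obtain ⟨c, s, hs⟩ := hcog Y
    obtain ⟨g, rfl⟩ := (ht c Y).2 s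
    obtain ⟨X, f, hfg⟩ := exists_isWeaklyExact_left g
    have hf : f = 0 := hs f (by
      rw [dualPullback_dualPullback, hfg.comp_eq_zero, map_zero])
    obtain ⟨r, hr⟩ := (hfg.weakCokernel (𝟙 Y)).1 (by rw [hf, zero_comp])
    obtain ⟨ε, hε⟩ := S.map_surjective (X := c) (Y := c) (r ≫ g)
    have hidem : ε ≫ ε = ε := S.map_injective (by
      rw [S.map_comp, hε]
      simp [reassoc_of% hr])
    obtain ⟨R, i, q, hiq, hqi⟩ := IsIdempotentComplete.idempotents_split c ε hidem
    refine ⟨R, ⟨S.map i ≫ r, g ≫ S.map q, ?_, ?_⟩⟩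
    · calc (S.map i ≫ r) ≫ g ≫ S.map q = S.map i ≫ (r ≫ g) ≫ S.map q := by simp
        _ = S.map ((i ≫ q) ≫ (i ≫ q)) := by rw [← hε, ← hqi]; simp
        _ = 𝟙 _ := by rw [hiq]; simp
    · calc (g ≫ S.map q) ≫ S.map i ≫ r = g ≫ S.map (q ≫ i) ≫ r := by simp
        _ = (g ≫ r) ≫ g ≫ r := by rw [hqi, hε]; simp
        _ = 𝟙 Y := by rw [hr]; simp⟩
  exact ⟨S, { }, isRightSerreFunctor_of_isUniversalFunctional ht hmap⟩

end SerreCriterion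

section RightDetermined

variable {k : Type v} [CommRing k] {E : Type v} [AddCommGroup E] [Module k E]
variable {C : Type u} [Category.{v} C] [Preadditive C] [Linear k C]

/-- An `End(c)`-submodule of `Hom(c, Y)`, regarded as a `k`-submodule. -/
def homSubmodule (k : Type v) [CommRing k] [Linear k C] {c Y : C}
    (H : Submodule (End c)ᵐᵒᵖ (c ⟶ Y)) : Submodule k (c ⟶ Y) where
  carrier := H
  add_mem' := H.add_mem
  zero_mem' := H.zero_mem
  smul_mem' r f hf := by
    have h : (r • 𝟙 c) ≫ f ∈ H := H.smul_mem (MulOpposite.op (r • 𝟙 c : End c)) hf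
    rwa [Linear.smul_comp, Category.id_comp] at h

theorem HasRightDeterminedMorphisms.exists_relation (h : HasRightDeterminedMorphisms C) {c Y : C}
    (y : (c ⟶ Y) →ₗ[k] E) : ∃ (X : C) (α : X ⟶ Y), ∀ ⦃Z : C⦄ (f : Z ⟶ Y),
      dualPullback y Z f = 0 ↔ FactorsThru f α := by
  let H : Submodule (End c)ᵐᵒᵖ (c ⟶ Y) :=
    { carrier := {f | dualPullback y c f = 0}
      add_mem' := fun {a b} ha hb => by
        change dualPullback y c (a + b) = 0
        rw [map_add, ha, hb, add_zero]
      zero_mem' := map_zero _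
      smul_mem' := fun γ f hf => by
        ext φ
        change y (φ ≫ γ.unop ≫ f) = 0
        rw [← Category.assoc]
        exact LinearMap.congr_fun hf (φ ≫ γ.unop) }
  obtain ⟨X, α, hα, him⟩ := h.1 c Y H
  refine ⟨X, α, fun Z f => ?_⟩
  rw [hα f]
  have hmem (g : c ⟶ Y) : FactorsThru g α ↔ dualPullback y c g = 0 := Set.ext_iff.1 him g
  simp_rw [hmem]
  constructor
  · intro hf φ
    rw [← dualPullback_dualPullback, hf]
    rfl
  · intro hf
    ext φ
    simpa using LinearMap.congr_fun (hf φ) (𝟙 c)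

variable [IsArtinianRing k]

theorem IsInjectiveEnvelopeOfResidueField.mem_iff_forall
    (hE : IsInjectiveEnvelopeOfResidueField k E) {M : Type v} [AddCommGroup M] [Module k M]
    (N : Submodule k M) (m : M) :
    m ∈ N ↔ ∀ ψ : M →ₗ[k] E, (∀ n ∈ N, ψ n = 0) → ψ m = 0 := by
  refine ⟨fun hm ψ hψ => hψ m hm, fun h => ?_⟩
  rw [← Submodule.Quotient.mk_eq_zero N]
  refine hE.eq_zero_of_forall fun χ => h (χ ∘ₗ N.mkQ) fun n hn => ?_
  rw [LinearMap.comp_apply, Submodule.mkQ_apply, (Submodule.Quotient.mk_eq_zero N).2 hn, map_zero]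

theorem IsInjectiveEnvelopeOfResidueField.fg_of_dual
    (hE : IsInjectiveEnvelopeOfResidueField k E) {M : Type v} [AddCommGroup M] [Module k M]
    (hM : IsFiniteLength k M) (N : Submodule k (M →ₗ[k] E)) : N.FG := by
  have := (isFiniteLength_iff_isNoetherian_isArtinian.1 (hE.isFiniteLength_dual hM)).1
  exact IsNoetherian.noetherian N

variable [HasZeroObject C] [HasShift C ℤ] [∀ n : ℤ, (shiftFunctor C n).Additive]
  [Pretriangulated C]

theorem HasSerreFunctor.hasRightDeterminedMorphisms (h : HasSerreFunctor k E C)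
    (hE : IsInjectiveEnvelopeOfResidueField k E)
    (homFinite : ∀ A B : C, IsFiniteLength k (A ⟶ B)) : HasRightDeterminedMorphisms C := by
  constructor
  · intro c Y H
    let N : Submodule k ((c ⟶ Y) →ₗ[k] E) :=
      { carrier := {ν | ∀ f ∈ homSubmodule k H, ν f = 0}
        add_mem' := fun {a b} ha hb f hf => by simp [ha f hf, hb f hf]
        zero_mem' := fun f _ => rfl
        smul_mem' := fun r a ha f hf => by simp [ha f hf] }
    obtain ⟨c', y, hy⟩ := exists_cogenerator_of_fg N (hE.fg_of_dual (homFinite _ _) N)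
    obtain ⟨W, t, ht⟩ := h.exists_isUniversalFunctional c'
    obtain ⟨g, rfl⟩ := (ht Y).2 y
    obtain ⟨X, α, hα⟩ := exists_isWeaklyExact_left g
    have key ⦃X' : C⦄ (α' : X' ⟶ Y) : FactorsThru α' α ↔ ∀ φ : c ⟶ X', φ ≫ α' ∈ H := by
      rw [← hα.weakKernel, ← (ht X').1.eq_iff, map_zero, ← dualPullback_dualPullback, hy]
      trans ∀ φ : c ⟶ X', φ ≫ α' ∈ homSubmodule k H
      · refine Iff.trans ?_
          (forall_congr' fun φ => (hE.mem_iff_forall (homSubmodule k H) _).symm)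
        exact ⟨fun h φ ν hν => LinearMap.congr_fun (h ν hν) φ,
          fun h ν hν => LinearMap.ext fun φ => h φ ν hν⟩
      · rfl
    have keyc (f : c ⟶ Y) : FactorsThru f α ↔ f ∈ H := by
      rw [key]
      exact ⟨fun h => by simpa using h (𝟙 c), fun h φ => H.smul_mem (MulOpposite.op φ) h⟩
    refine ⟨X, α, fun X' α' => ?_, Set.ext fun f => keyc f⟩
    rw [key]
    exact forall_congr' fun φ => (keyc _).symm
  · intro X Y α
    obtain ⟨Z, g, hg⟩ := exists_isWeaklyExact_right α
    obtain ⟨c, t, ht⟩ := h.exists_isUniversalFunctional_of_target Z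
    refine ⟨c, fun X' α' => ⟨?_, fun hα' => ?_⟩⟩
    · rintro ⟨l, rfl⟩ φ
      exact ⟨φ ≫ l, Category.assoc _ _ _⟩
    · refine (hg.weakKernel α').1 ((ht X').1 ?_)
      rw [map_zero]
      ext φ
      have := (hg.weakKernel _).2 (hα' φ)
      rw [Category.assoc] at this
      rw [dualPullback_apply, this, map_zero, LinearMap.zero_apply]

theorem HasRightDeterminedMorphisms.exists_isUniversalFunctional [IsIdempotentComplete C]
    (h : HasRightDeterminedMorphisms C) (hE : IsInjectiveEnvelopeOfResidueField k E)
    (homFinite : ∀ A B : C, IsFiniteLength k (A ⟶ B)) (c : C) :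
    ∃ (W : C) (t : (c ⟶ W) →ₗ[k] E), IsUniversalFunctional t := by
  have hgen (Z : C) : ∃ (Y : C) (y : (c ⟶ Y) →ₗ[k] E),
      Function.Surjective (dualPullback y Z) := by
    obtain ⟨Y, y, hy⟩ := exists_generator_of_fg (k := k) (E := E) (c := c) (Z := Z) ⊤
      (hE.fg_of_dual (homFinite _ _) _)
    exact ⟨Y, y, fun z => hy z trivial⟩
  obtain ⟨Y, y, hy⟩ := hgen c
  obtain ⟨X, α, hα⟩ := h.exists_relation y
  obtain ⟨W, g, hg⟩ := exists_isWeaklyExact_right α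
  obtain ⟨w, hw⟩ := hg.exists_dualPullback_eq hE.1 y ((hα α).2 ⟨𝟙 X, Category.id_comp α⟩)
  have hsurj (Z : C) : Function.Surjective (dualPullback w Z) := by
    obtain ⟨Y₁, y₁, hy₁⟩ := hgen Z
    let Y' := Y ⊞ Y₁
    let y' : (c ⟶ Y') →ₗ[k] E :=
      dualPullback y _ biprod.fst + dualPullback y₁ _ biprod.snd
    have hinl : dualPullback y' Y biprod.inl = y := by
      ext; simp [y']
    have hinr : dualPullback y' Y₁ biprod.inr = y₁ := by
      ext; simp [y']
    obtain ⟨X', α', hα'⟩ := h.exists_relation y'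
    obtain ⟨W', g', hg'⟩ := exists_isWeaklyExact_right α'
    obtain ⟨V, v, hv⟩ := exists_isWeaklyExact_left (biprod.inl ≫ g')
    obtain ⟨r, hr⟩ : ∃ r : W' ⟶ W, (biprod.inl ≫ g') ≫ r = g := by
      refine (hv.weakCokernel g).1 ((hg.weakKernel v).2 ((hα v).1 ?_))
      rw [← hinl, dualPullback_dualPullback, hα', ← hg'.weakKernel, Category.assoc]
      exact hv.comp_eq_zero
    let y'' : (c ⟶ Y') →ₗ[k] E := dualPullback w Y' (g' ≫ r)
    have hinl' : dualPullback y'' Y biprod.inl = y := by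
      rw [dualPullback_dualPullback, ← Category.assoc, hr, hw]
    have hker (T : C) : LinearMap.ker (dualPullback y' T) ≤ LinearMap.ker (dualPullback y'' T) := by
      intro a ha
      have h0 : a ≫ g' = 0 := (hg'.weakKernel a).2 ((hα' a).1 ha)
      rw [LinearMap.mem_ker, dualPullback_dualPullback, ← Category.assoc, h0, zero_comp, map_zero]
    have hker' : LinearMap.ker (dualPullback y'' Z) ≤ LinearMap.ker (dualPullback y' Z) := by
      intro a ha
      ext φ
      obtain ⟨b, hb⟩ := hy (dualPullback y' c (φ ≫ a))
      have h1 : dualPullback y' c (φ ≫ a - b ≫ biprod.inl) = 0 := by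
        rw [map_sub, ← hb, ← dualPullback_dualPullback y' biprod.inl, hinl, sub_self]
      have h2 : dualPullback y'' c (φ ≫ a - b ≫ biprod.inl) = 0 := hker c h1
      rw [map_sub, ← dualPullback_dualPullback y'' biprod.inl, hinl', hb,
        ← dualPullback_dualPullback y'' a, LinearMap.mem_ker.1 ha, sub_eq_zero] at h2
      simpa using (LinearMap.congr_fun h2 (𝟙 c)).symm
    have hsurj' : Function.Surjective (dualPullback y' Z) := by
      intro z
      obtain ⟨f, rfl⟩ := hy₁ z
      exact ⟨f ≫ biprod.inr, by rw [← dualPullback_dualPullback, hinr]⟩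
    let e := (dualPullback y' Z).quotKerEquivOfSurjective hsurj'
    let θ : ((c ⟶ Z) →ₗ[k] E) →ₗ[k] ((c ⟶ Z) →ₗ[k] E) :=
      (LinearMap.ker (dualPullback y' Z)).liftQ (dualPullback y'' Z) (hker Z) ∘ₗ
        e.symm.toLinearMap
    have hθinj : Function.Injective θ := by
      have hlift : Function.Injective
          ((LinearMap.ker (dualPullback y' Z)).liftQ (dualPullback y'' Z) (hker Z)) :=
        LinearMap.ker_eq_bot.1 (Submodule.ker_liftQ_eq_bot _ _ _ hker')
      exact hlift.comp e.symm.injective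
    have := (isFiniteLength_iff_isNoetherian_isArtinian.1
      (hE.isFiniteLength_dual (homFinite c Z))).2
    intro z
    obtain ⟨z', rfl⟩ := IsArtinian.surjective_of_injective_endomorphism θ hθinj z
    obtain ⟨q, rfl⟩ := e.surjective z'
    obtain ⟨a, rfl⟩ := Submodule.mkQ_surjective _ q
    refine ⟨a ≫ g' ≫ r, ?_⟩
    rw [← dualPullback_dualPullback]
    change _ = (LinearMap.ker (dualPullback y' Z)).liftQ (dualPullback y'' Z) (hker Z)
        (e.symm (e (Submodule.mkQ _ a)))
    rw [LinearEquiv.symm_apply_apply]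
    rfl
  obtain ⟨X₂, α₂, hα₂⟩ := h.exists_relation w
  obtain ⟨W₂, g₂, hg₂⟩ := exists_isWeaklyExact_right α₂
  exact exists_isUniversalFunctional_of_presentation hE.1 hg₂ w hsurj hα₂

theorem HasRightDeterminedMorphisms.hasSerreFunctor [IsIdempotentComplete C]
    (h : HasRightDeterminedMorphisms C) (hE : IsInjectiveEnvelopeOfResidueField k E)
    (homFinite : ∀ A B : C, IsFiniteLength k (A ⟶ B)) : HasSerreFunctor k E C := by
  refine hasSerreFunctor_of_exists_isUniversalFunctional hE homFinite
    (h.exists_isUniversalFunctional hE homFinite) fun Y => ?_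
  obtain ⟨Z, -⟩ := HasZeroObject.zero (C := C)
  obtain ⟨c, hc⟩ := h.2 (0 : Z ⟶ Y)
  obtain ⟨c', t, ht⟩ := exists_cogenerator_of_fg (k := k) (E := E) (c := c) (Y := Y) ⊤
    (hE.fg_of_dual (homFinite _ _) _)
  refine ⟨c', t, fun X α hα => ?_⟩
  obtain ⟨l, hl⟩ := (hc α).2 fun φ => ⟨0, by
    rw [comp_zero, eq_comm]
    exact hE.eq_zero_of_forall fun ψ => LinearMap.congr_fun ((ht α).1 hα ψ trivial) φ⟩
  rw [← hl, comp_zero]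

end RightDetermined

section Presentation

variable {k : Type v} [CommRing k]

theorem cokernel_π_app_surjective {J : Type*} [Category* J] {F G : J ⥤ ModuleCat.{v} k} (a : F ⟶ G)
    (j : J) : Function.Surjective ((cokernel.π a).app j).hom :=
  (ModuleCat.epi_iff_surjective _).1 inferInstance

theorem cokernel_π_app_eq_zero_iff {J : Type*} [Category* J] {F G : J ⥤ ModuleCat.{v} k}
    (a : F ⟶ G) (j : J) (x : G.obj j) :
    ((cokernel.π a).app j).hom x = 0 ↔ ∃ y, (a.app j).hom y = x := by
  constructor
  · have h := (ShortComplex.exact_of_g_is_cokernel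
      (ShortComplex.mk a (cokernel.π a) (cokernel.condition a)) (cokernelIsCokernel a)).map
      ((evaluation J (ModuleCat.{v} k)).obj j)
    exact (ShortComplex.moduleCat_exact_iff _).1 h x
  · rintro ⟨y, rfl⟩
    exact ConcreteCategory.congr_hom (NatTrans.congr_app (cokernel.condition a) j) y

theorem nonempty_iso_cokernel {J : Type*} [Category* J] {F G H : J ⥤ ModuleCat.{v} k} (a : F ⟶ G)
    (b : G ⟶ H) (hb : ∀ j, Function.Surjective (b.app j).hom)
    (hab : ∀ (j : J) (x : G.obj j), (b.app j).hom x = 0 ↔ ∃ y, (a.app j).hom y = x) :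
    Nonempty (H ≅ cokernel a) := by
  have w : a ≫ b = 0 := by
    ext j y
    exact (hab j _).2 ⟨y, rfl⟩
  have hπ (j : J) (x : G.obj j) :
      ((cokernel.desc a b w).app j).hom (((cokernel.π a).app j).hom x) = (b.app j).hom x :=
    ConcreteCategory.congr_hom (NatTrans.congr_app (cokernel.π_desc a b w) j) x
  have (j : J) : IsIso ((cokernel.desc a b w).app j) := by
    refine (ConcreteCategory.isIso_iff_bijective _).2 ⟨?_, fun z => ?_⟩
    · refine (injective_iff_map_eq_zero ((cokernel.desc a b w).app j).hom).2 fun z hz => ?_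
      obtain ⟨x, rfl⟩ := cokernel_π_app_surjective a j z
      rw [hπ, hab] at hz
      exact (cokernel_π_app_eq_zero_iff a j x).2 hz
    · obtain ⟨x, rfl⟩ := hb j z
      exact ⟨_, hπ j x⟩
  have := NatIso.isIso_of_isIso_app (cokernel.desc a b w)
  exact ⟨(asIso (cokernel.desc a b w)).symm⟩

variable {C : Type u} [Category.{v} C] [Preadditive C] [Linear k C]

/-- A presentation of a presheaf as the cokernel of `Hom(-, X) → Hom(-, Y)`. -/
structure IsContraPresentation {F : Cᵒᵖ ⥤ ModuleCat.{v} k} {X Y : C} (p : X ⟶ Y)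
    (ρ : ∀ Z : C, (Z ⟶ Y) →ₗ[k] F.obj (op Z)) : Prop where
  map_comp : ∀ ⦃Z' Z : C⦄ (f : Z' ⟶ Z) (g : Z ⟶ Y), ρ Z' (f ≫ g) = (F.map f.op).hom (ρ Z g)
  surjective : ∀ Z, Function.Surjective (ρ Z)
  eq_zero_iff : ∀ ⦃Z : C⦄ (f : Z ⟶ Y), ρ Z f = 0 ↔ FactorsThru f p

/-- A presentation of a copresheaf as the cokernel of `Hom(Y, -) → Hom(X, -)`. -/
structure IsCovPresentation {G : C ⥤ ModuleCat.{v} k} {X Y : C} (p : X ⟶ Y)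
    (ρ : ∀ Z : C, (X ⟶ Z) →ₗ[k] G.obj Z) : Prop where
  comp_map : ∀ ⦃Z Z' : C⦄ (g : X ⟶ Z) (f : Z ⟶ Z'), ρ Z' (g ≫ f) = (G.map f).hom (ρ Z g)
  surjective : ∀ Z, Function.Surjective (ρ Z)
  eq_zero_iff : ∀ ⦃Z : C⦄ (f : X ⟶ Z), ρ Z f = 0 ↔ ∃ l : Y ⟶ Z, p ≫ l = f

theorem isFPContra_iff (F : Cᵒᵖ ⥤ ModuleCat.{v} k) :
    IsFPContra k C F ↔ ∃ (X Y : C) (p : X ⟶ Y) (ρ : ∀ Z : C, (Z ⟶ Y) →ₗ[k] F.obj (op Z)),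
      IsContraPresentation p ρ := by
  constructor
  · rintro ⟨X, Y, p, ⟨e⟩⟩
    let b := cokernel.π ((linearYoneda k C).map p) ≫ e.inv
    have he (Z : C) : Function.Bijective (e.inv.app (op Z)).hom :=
      (ConcreteCategory.isIso_iff_bijective (e.inv.app (op Z))).1 inferInstance
    refine ⟨X, Y, p, fun Z => (b.app (op Z)).hom, fun Z' Z f g => ?_, fun Z => ?_, fun Z f => ?_⟩
    · exact ConcreteCategory.congr_hom (b.naturality f.op) g
    · exact (he Z).2.comp (cokernel_π_app_surjective _ (op Z))
    · exact (map_eq_zero_iff (e.inv.app (op Z)).hom (he Z).1).trans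
        (cokernel_π_app_eq_zero_iff ((linearYoneda k C).map p) (op Z) f)
  · rintro ⟨X, Y, p, ρ, hρ⟩
    let b : (linearYoneda k C).obj Y ⟶ F :=
      { app := fun Z => ModuleCat.ofHom (ρ Z.unop)
        naturality := fun Z Z' f => ModuleCat.hom_ext (LinearMap.ext fun g =>
          hρ.map_comp f.unop g) }
    exact ⟨X, Y, p, nonempty_iso_cokernel ((linearYoneda k C).map p) b
      (fun Z => hρ.surjective Z.unop) fun Z => hρ.eq_zero_iff (Z := Z.unop)⟩

theorem isFPCov_iff (G : C ⥤ ModuleCat.{v} k) :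
    IsFPCov k C G ↔ ∃ (X Y : C) (p : X ⟶ Y) (ρ : ∀ Z : C, (X ⟶ Z) →ₗ[k] G.obj Z),
      IsCovPresentation p ρ := by
  constructor
  · rintro ⟨X, Y, p, ⟨e⟩⟩
    let b := cokernel.π ((linearCoyoneda k C).map p.op) ≫ e.inv
    have he (Z : C) : Function.Bijective (e.inv.app Z).hom :=
      (ConcreteCategory.isIso_iff_bijective (e.inv.app Z)).1 inferInstance
    refine ⟨X, Y, p, fun Z => (b.app Z).hom, fun Z Z' g f => ?_, fun Z => ?_, fun Z f => ?_⟩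
    · exact ConcreteCategory.congr_hom (b.naturality f) g
    · exact (he Z).2.comp (cokernel_π_app_surjective _ Z)
    · exact (map_eq_zero_iff (e.inv.app Z).hom (he Z).1).trans
        (cokernel_π_app_eq_zero_iff ((linearCoyoneda k C).map p.op) Z f)
  · rintro ⟨X, Y, p, ρ, hρ⟩
    let b : (linearCoyoneda k C).obj (op X) ⟶ G :=
      { app := fun Z => ModuleCat.ofHom (ρ Z)
        naturality := fun Z Z' f => ModuleCat.hom_ext (LinearMap.ext fun g =>
          hρ.comp_map g f) }
    exact ⟨X, Y, p, nonempty_iso_cokernel ((linearCoyoneda k C).map p.op) b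
      hρ.surjective fun Z => hρ.eq_zero_iff (Z := Z)⟩

end Presentation

section Dualising

variable {k : Type v} [CommRing k] {E : Type v} [AddCommGroup E] [Module k E]
variable {C : Type u} [Category.{v} C]

/-- `F ↦ D ∘ F` is faithful. -/
theorem dualizeContra_map_injective [IsArtinianRing k]
    (hE : IsInjectiveEnvelopeOfResidueField k E) {F F' : Cᵒᵖ ⥤ ModuleCat.{v} k} {σ τ : F' ⟶ F}
    (h : (dualizeContra k E C).map σ.op = (dualizeContra k E C).map τ.op) : σ = τ := by
  ext Z y
  refine sub_eq_zero.1 (hE.eq_zero_of_forall fun ψ => ?_)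
  rw [map_sub, sub_eq_zero]
  let ψ' : F.obj Z ⟶ ModuleCat.of k E := ModuleCat.ofHom ψ
  have hψ := ConcreteCategory.congr_hom (NatTrans.congr_app h Z.unop) ψ'
  exact ConcreteCategory.congr_hom hψ y

/-- `F ↦ D ∘ F` is full on functors with values of finite length. -/
theorem exists_dualizeContra_map_eq [IsArtinianRing k]
    (hE : IsInjectiveEnvelopeOfResidueField k E) {F F' : Cᵒᵖ ⥤ ModuleCat.{v} k}
    (hF : ∀ Z, IsFiniteLength k (F.obj Z))
    (τ : (dualizeContra k E C).obj (op F) ⟶ (dualizeContra k E C).obj (op F')) :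
    ∃ σ : F' ⟶ F, (dualizeContra k E C).map σ.op = τ := by
  have hμ (Z : Cᵒᵖ) : ∃ μ : F'.obj Z →ₗ[k] F.obj Z, ∀ (ψ : F.obj Z ⟶ ModuleCat.of k E)
      (y : F'.obj Z), ((τ.app Z.unop).hom ψ).hom y = ψ.hom (μ y) := by
    let l : (F.obj Z →ₗ[k] E) →ₗ[k] (F'.obj Z →ₗ[k] E) :=
      (ModuleCat.homLinearEquiv (S := k)).toLinearMap ∘ₗ (τ.app Z.unop).hom ∘ₗ
        (ModuleCat.homLinearEquiv (S := k) (N := ModuleCat.of k E)).symm.toLinearMap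
    obtain ⟨μ, hμ⟩ := hE.exists_comp_eq (hF Z) l
    exact ⟨μ, fun ψ y => LinearMap.congr_fun (hμ ψ.hom) y⟩
  choose μ hμ using hμ
  refine ⟨{ app := fun Z => ModuleCat.ofHom (μ Z), naturality := fun Z Z' f => ?_ }, ?_⟩
  · ext y
    refine sub_eq_zero.1 (hE.eq_zero_of_forall fun ψ => ?_)
    rw [map_sub, sub_eq_zero]
    let ψ' : F.obj Z' ⟶ ModuleCat.of k E := ModuleCat.ofHom ψ
    have hψ := ConcreteCategory.congr_hom (τ.naturality f.unop) ψ'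
    have hy := ConcreteCategory.congr_hom hψ y
    exact ((hμ Z' ψ' ((F'.map f).hom y)).symm.trans hy.symm).trans (hμ Z (F.map f ≫ ψ') y)
  · ext Z ψ
    refine ModuleCat.hom_ext (LinearMap.ext fun y => ?_)
    exact (hμ (op Z) ψ y).symm

/-- Biduality for functors with values of finite length. -/
theorem nonempty_dualizeContra_dualizeCov_iso [IsArtinianRing k]
    (hE : IsInjectiveEnvelopeOfResidueField k E) {G : C ⥤ ModuleCat.{v} k}
    (hG : ∀ Z, IsFiniteLength k (G.obj Z)) :
    Nonempty ((dualizeContra k E C).obj (op ((dualizeCov k E C).obj (op G))) ≅ G) := by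
  let ev (Z : C) : G.obj Z →ₗ[k] (G.obj Z ⟶ ModuleCat.of k E) →ₗ[k] E :=
    (ModuleCat.homLinearEquiv (S := k)).toLinearMap.flip
  let η : G ⟶ (dualizeContra k E C).obj (op ((dualizeCov k E C).obj (op G))) :=
    { app := fun Z => ModuleCat.ofHom
        ((ModuleCat.homLinearEquiv (S := k)).symm.toLinearMap ∘ₗ ev Z)
      naturality := fun Z Z' f => rfl }
  have (Z : C) : IsIso (η.app Z) := by
    refine (ConcreteCategory.isIso_iff_bijective _).2 ⟨?_, fun θ => ?_⟩
    · refine (injective_iff_map_eq_zero (η.app Z).hom).2 fun m hm => ?_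
      refine hE.eq_zero_of_forall fun ψ => ?_
      let ψ' : G.obj Z ⟶ ModuleCat.of k E := ModuleCat.ofHom ψ
      exact ConcreteCategory.congr_hom hm ψ'
    · obtain ⟨m, hm⟩ := hE.exists_eval_eq (hG Z)
        (θ.hom ∘ₗ (ModuleCat.homLinearEquiv (S := k) (N := ModuleCat.of k E)).symm.toLinearMap)
      exact ⟨m, ModuleCat.hom_ext (LinearMap.ext fun ψ => (hm ψ.hom).symm)⟩
  have := NatIso.isIso_of_isIso_app η
  exact ⟨(asIso η).symm⟩

variable [Preadditive C] [Linear k C]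

theorem IsContraPresentation.isFiniteLength {F : Cᵒᵖ ⥤ ModuleCat.{v} k} {X Y : C} {p : X ⟶ Y}
    {ρ : ∀ Z : C, (Z ⟶ Y) →ₗ[k] F.obj (op Z)} (hρ : IsContraPresentation p ρ)
    (homFinite : ∀ A B : C, IsFiniteLength k (A ⟶ B)) (Z : C) :
    IsFiniteLength k (F.obj (op Z)) :=
  (homFinite Z Y).of_surjective (hρ.surjective Z)

theorem IsCovPresentation.isFiniteLength {G : C ⥤ ModuleCat.{v} k} {X Y : C} {p : X ⟶ Y}
    {ρ : ∀ Z : C, (X ⟶ Z) →ₗ[k] G.obj Z} (hρ : IsCovPresentation p ρ)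
    (homFinite : ∀ A B : C, IsFiniteLength k (A ⟶ B)) (Z : C) :
    IsFiniteLength k (G.obj Z) :=
  (homFinite X Z).of_surjective (hρ.surjective Z)

theorem isFPContra_linearYoneda (Y : C) : IsFPContra k C ((linearYoneda k C).obj Y) :=
  (isFPContra_iff _).2 ⟨Y, Y, 0, fun _ => LinearMap.id, fun _ _ _ _ => rfl,
    fun _ => Function.surjective_id, fun _ f => ⟨fun h => ⟨0, by rw [comp_zero]; exact h.symm⟩, by
      rintro ⟨l, rfl⟩
      exact comp_zero⟩⟩

theorem isFPCov_linearCoyoneda (X : C) : IsFPCov k C ((linearCoyoneda k C).obj (op X)) :=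
  (isFPCov_iff _).2 ⟨X, X, 0, fun _ => LinearMap.id, fun _ _ _ _ => rfl,
    fun _ => Function.surjective_id, fun _ f => ⟨fun h => ⟨0, by rw [comp_zero]; exact h.symm⟩, by
      rintro ⟨l, rfl⟩
      exact zero_comp⟩⟩

theorem IsDualisingVariety.exists_iso (h : IsDualisingVariety k E C) {G : C ⥤ ModuleCat.{v} k}
    (hG : IsFPCov k C G) : ∃ F : Cᵒᵖ ⥤ ModuleCat.{v} k, IsFPContra k C F ∧
      Nonempty ((dualizeContra k E C).obj (op F) ≅ G) := by
  obtain ⟨h, _⟩ := h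
  let L := ObjectProperty.lift (IsFPCov k C)
    ((ObjectProperty.ι (IsFPContra k C)).op ⋙ dualizeContra k E C) (fun F => h F.unop)
  exact ⟨(L.objPreimage ⟨G, hG⟩).unop.obj, (L.objPreimage ⟨G, hG⟩).unop.property,
    ⟨(ObjectProperty.ι (IsFPCov k C)).mapIso (L.objObjPreimageIso ⟨G, hG⟩)⟩⟩

theorem IsDualisingVariety.exists_isUniversalFunctional [IsArtinianRing k] [HasZeroObject C]
    [HasShift C ℤ] [∀ n : ℤ, (shiftFunctor C n).Additive] [Pretriangulated C]
    [IsIdempotentComplete C] (h : IsDualisingVariety k E C)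
    (hE : IsInjectiveEnvelopeOfResidueField k E)
    (homFinite : ∀ A B : C, IsFiniteLength k (A ⟶ B)) (c : C) :
    ∃ (W : C) (t : (c ⟶ W) →ₗ[k] E), IsUniversalFunctional t := by
  obtain ⟨F, hF, ⟨e⟩⟩ := h.exists_iso (isFPCov_linearCoyoneda (k := k) c)
  obtain ⟨X, Y, p, ρ, hρ⟩ := (isFPContra_iff F).1 hF
  let B (Z : C) : (c ⟶ Z) →ₗ[k] F.obj (op Z) →ₗ[k] E :=
    (ModuleCat.homLinearEquiv (S := k)).toLinearMap ∘ₗ (e.inv.app Z).hom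
  have hB (Z : C) : Function.Bijective (B Z).flip :=
    hE.bijective_flip (hρ.isFiniteLength homFinite Z) (B Z)
      ((ModuleCat.homLinearEquiv (S := k)).bijective.comp
        ((ConcreteCategory.isIso_iff_bijective (e.inv.app Z)).1 inferInstance))
  have hnat {Z Z' : C} (φ : c ⟶ Z) (f : Z ⟶ Z') (y : F.obj (op Z')) :
      B Z' (φ ≫ f) y = B Z φ ((F.map f.op).hom y) := by
    have := ConcreteCategory.congr_hom (e.inv.naturality f) φ
    exact ConcreteCategory.congr_hom this y
  let t : (c ⟶ Y) →ₗ[k] E := (B Y).flip (ρ Y (𝟙 Y))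
  have ht (Z : C) (f : Z ⟶ Y) : dualPullback t Z f = (B Z).flip (ρ Z f) := by
    ext φ
    have := hρ.map_comp f (𝟙 Y)
    rw [Category.comp_id] at this
    rw [this]
    exact hnat φ f _
  obtain ⟨V, β, hβ⟩ := exists_isWeaklyExact_right p
  refine exists_isUniversalFunctional_of_presentation hE.1 hβ t (fun Z z => ?_) fun Z f => ?_
  · obtain ⟨y, rfl⟩ := (hB Z).2 z
    obtain ⟨f, rfl⟩ := hρ.surjective Z y
    exact ⟨f, ht Z f⟩
  · rw [ht, map_eq_zero_iff _ (hB Z).1, hρ.eq_zero_iff]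

theorem IsDualisingVariety.hasSerreFunctor [IsArtinianRing k] [HasZeroObject C]
    [HasShift C ℤ] [∀ n : ℤ, (shiftFunctor C n).Additive] [Pretriangulated C]
    [IsIdempotentComplete C] (h : IsDualisingVariety k E C)
    (hE : IsInjectiveEnvelopeOfResidueField k E)
    (homFinite : ∀ A B : C, IsFiniteLength k (A ⟶ B)) : HasSerreFunctor k E C := by
  refine hasSerreFunctor_of_exists_isUniversalFunctional hE homFinite
    (h.exists_isUniversalFunctional hE homFinite) fun Y => ?_
  obtain ⟨X, _, _, ρ, hρ⟩ := (isFPCov_iff _).1 (h.1 ⟨_, isFPContra_linearYoneda (k := k) Y⟩)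
  refine ⟨X, (ρ X (𝟙 X)).hom, fun Z α hα => hE.eq_zero_of_forall fun ψ => ?_⟩
  obtain ⟨φ, hφ⟩ := hρ.surjective Z (ModuleCat.ofHom ψ)
  have := hρ.comp_map (𝟙 X) φ
  rw [Category.id_comp, hφ] at this
  exact (ConcreteCategory.congr_hom this α).trans (LinearMap.congr_fun hα φ)

end Dualising

section DualPresentation

variable {k : Type v} [CommRing k] {E : Type v} [AddCommGroup E] [Module k E]
variable {C : Type u} [Category.{v} C] [Preadditive C] [Linear k C] [HasZeroObject C]
  [HasShift C ℤ] [∀ n : ℤ, (shiftFunctor C n).Additive] [Pretriangulated C]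

theorem HasSerreFunctor.isFPContra_dualizeCov (h : HasSerreFunctor k E C)
    (hE : IsInjectiveEnvelopeOfResidueField k E) {G : C ⥤ ModuleCat.{v} k}
    (hG : IsFPCov k C G) : IsFPContra k C ((dualizeCov k E C).obj (op G)) := by
  obtain ⟨X, Y, p, ρ, hρ⟩ := (isFPCov_iff G).1 hG
  obtain ⟨X', tX, htX⟩ := h.exists_isUniversalFunctional X
  obtain ⟨Y', tY, htY⟩ := h.exists_isUniversalFunctional Y
  obtain ⟨p', hp'⟩ := (htY X').2 (tX ∘ₗ Linear.leftComp k X' p)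
  have hp {Z : C} (φ : Z ⟶ X') (f : Y ⟶ Z) : tY (f ≫ φ ≫ p') = tX ((p ≫ f) ≫ φ) := by
    have := LinearMap.congr_fun hp' (f ≫ φ)
    simpa using this
  obtain ⟨V, j, hj⟩ := exists_isWeaklyExact_left p'
  obtain ⟨_, q, hq⟩ := exists_isWeaklyExact_left j
  obtain ⟨s, hs⟩ := hE.1.exists_comp_eq (ρ V) (dualPullback tX V j) fun f hf => by
    obtain ⟨l, rfl⟩ := (hρ.eq_zero_iff f).1 hf
    have := hp j l
    rw [hj.comp_eq_zero, comp_zero, map_zero] at this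
    exact this.symm
  have hsG {Z : C} (g : Z ⟶ V) (f : X ⟶ Z) :
      s ((G.map g).hom (ρ Z f)) = tX (f ≫ g ≫ j) := by
    rw [← hρ.comp_map, ← Category.assoc]
    exact LinearMap.congr_fun hs (f ≫ g)
  let ρ' (Z : C) : (Z ⟶ V) →ₗ[k] (G.obj Z ⟶ ModuleCat.of k E) :=
    { toFun := fun g => ModuleCat.ofHom (s ∘ₗ (G.map g).hom)
      map_add' := fun g g' => by
        ext y
        obtain ⟨f, rfl⟩ := hρ.surjective Z y
        refine (hsG (g + g') f).trans (Eq.trans ?_ (congrArg₂ (· + ·) (hsG g f) (hsG g' f)).symm)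
        simp
      map_smul' := fun r g => by
        ext y
        obtain ⟨f, rfl⟩ := hρ.surjective Z y
        refine (hsG (r • g) f).trans (Eq.trans ?_ (congrArg (r • ·) (hsG g f)).symm)
        simp }
  refine (isFPContra_iff _).2 ⟨_, V, q, ρ', fun Z' Z f g => ?_, fun Z ψ => ?_, fun Z g => ?_⟩
  · refine ModuleCat.hom_ext (LinearMap.ext fun y => ?_)
    exact congrArg s (ConcreteCategory.congr_hom (G.map_comp f g) y)
  · let ψ' : G.obj Z →ₗ[k] E := ModuleCat.Hom.hom ψ
    obtain ⟨φ, hφ⟩ := (htX Z).2 (ψ' ∘ₗ ρ Z)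
    obtain ⟨g, rfl⟩ : FactorsThru φ j := by
      refine (hj.weakKernel φ).1 ((htY Z).1 ?_)
      rw [map_zero]
      ext f
      refine (hp φ f).trans ((LinearMap.congr_fun hφ (p ≫ f)).trans ?_)
      rw [LinearMap.comp_apply, (hρ.eq_zero_iff _).2 ⟨f, rfl⟩, map_zero, LinearMap.zero_apply]
    refine ⟨g, ModuleCat.hom_ext (LinearMap.ext fun y => ?_)⟩
    obtain ⟨f, rfl⟩ := hρ.surjective Z y
    exact (hsG g f).trans (LinearMap.congr_fun hφ f)
  · rw [← hq.weakKernel, ← map_eq_zero_iff _ (htX Z).1]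
    constructor
    · intro hg
      ext f
      exact (hsG g f).symm.trans (ConcreteCategory.congr_hom hg (ρ Z f))
    · intro hg
      refine ModuleCat.hom_ext (LinearMap.ext fun y => ?_)
      obtain ⟨f, rfl⟩ := hρ.surjective Z y
      exact (hsG g f).trans (LinearMap.congr_fun hg f)

variable [IsArtinianRing k]

theorem HasSerreFunctor.isFPCov_dualizeContra (h : HasSerreFunctor k E C)
    (hE : IsInjectiveEnvelopeOfResidueField k E)
    (homFinite : ∀ A B : C, IsFiniteLength k (A ⟶ B)) {F : Cᵒᵖ ⥤ ModuleCat.{v} k}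
    (hF : IsFPContra k C F) : IsFPCov k C ((dualizeContra k E C).obj (op F)) := by
  obtain ⟨X, Y, p, ρ, hρ⟩ := (isFPContra_iff F).1 hF
  obtain ⟨X', tX, htX⟩ := h.exists_isUniversalFunctional_of_target X
  obtain ⟨Y', tY, htY⟩ := h.exists_isUniversalFunctional_of_target Y
  have hflipX (Z : C) : Function.Bijective (dualPullback tX Z).flip :=
    hE.bijective_flip (homFinite X' Z) _ (htX Z)
  have hflipY (Z : C) : Function.Bijective (dualPullback tY Z).flip :=
    hE.bijective_flip (homFinite Y' Z) _ (htY Z)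
  obtain ⟨p', hp'⟩ := (hflipX Y').2 (tY ∘ₗ Linear.rightComp k Y' p)
  have hp {Z : C} (φ : Y' ⟶ Z) (f : Z ⟶ X) : tX ((p' ≫ φ) ≫ f) = tY (φ ≫ f ≫ p) := by
    have := LinearMap.congr_fun hp' (φ ≫ f)
    simpa using this
  obtain ⟨V, j, hj⟩ := exists_isWeaklyExact_right p'
  obtain ⟨_, q, hq⟩ := exists_isWeaklyExact_right j
  obtain ⟨s, hs⟩ := hE.1.exists_comp_eq (ρ V) (tY ∘ₗ Linear.leftComp k Y j) fun f hf => by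
    obtain ⟨l, rfl⟩ := (hρ.eq_zero_iff f).1 hf
    have := hp j l
    rw [hj.comp_eq_zero, zero_comp, map_zero] at this
    exact this.symm
  have hsF {Z : C} (g : V ⟶ Z) (f : Z ⟶ Y) :
      s ((F.map g.op).hom (ρ Z f)) = tY ((j ≫ g) ≫ f) := by
    rw [← hρ.map_comp, Category.assoc]
    exact LinearMap.congr_fun hs (g ≫ f)
  let ρ' (Z : C) : (V ⟶ Z) →ₗ[k] (F.obj (op Z) ⟶ ModuleCat.of k E) :=
    { toFun := fun g => ModuleCat.ofHom (s ∘ₗ (F.map g.op).hom)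
      map_add' := fun g g' => by
        ext y
        obtain ⟨f, rfl⟩ := hρ.surjective Z y
        refine (hsF (g + g') f).trans (Eq.trans ?_ (congrArg₂ (· + ·) (hsF g f) (hsF g' f)).symm)
        simp
      map_smul' := fun r g => by
        ext y
        obtain ⟨f, rfl⟩ := hρ.surjective Z y
        refine (hsF (r • g) f).trans (Eq.trans ?_ (congrArg (r • ·) (hsF g f)).symm)
        simp }
  refine (isFPCov_iff _).2 ⟨V, _, q, ρ', fun Z Z' g f => ?_, fun Z ψ => ?_, fun Z g => ?_⟩
  · refine ModuleCat.hom_ext (LinearMap.ext fun y => ?_)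
    exact congrArg s (ConcreteCategory.congr_hom (F.map_comp f.op g.op) y)
  · let ψ' : F.obj (op Z) →ₗ[k] E := ModuleCat.Hom.hom ψ
    obtain ⟨φ, hφ⟩ := (hflipY Z).2 (ψ' ∘ₗ ρ Z)
    obtain ⟨g, rfl⟩ : ∃ g : V ⟶ Z, j ≫ g = φ := by
      refine (hj.weakCokernel φ).1 ((hflipX Z).1 ?_)
      rw [map_zero]
      ext f
      refine (hp φ f).trans ((LinearMap.congr_fun hφ (f ≫ p)).trans ?_)
      rw [LinearMap.comp_apply, (hρ.eq_zero_iff _).2 ⟨f, rfl⟩, map_zero, LinearMap.zero_apply]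
    refine ⟨g, ModuleCat.hom_ext (LinearMap.ext fun y => ?_)⟩
    obtain ⟨f, rfl⟩ := hρ.surjective Z y
    exact (hsF g f).trans (LinearMap.congr_fun hφ f)
  · rw [← hq.weakCokernel, ← map_eq_zero_iff _ (hflipY Z).1]
    constructor
    · intro hg
      ext f
      exact (hsF g f).symm.trans (ConcreteCategory.congr_hom hg (ρ Z f))
    · intro hg
      refine ModuleCat.hom_ext (LinearMap.ext fun y => ?_)
      obtain ⟨f, rfl⟩ := hρ.surjective Z y
      exact (hsF g f).trans (LinearMap.congr_fun hg f)

theorem HasSerreFunctor.isDualisingVariety (h : HasSerreFunctor k E C)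
    (hE : IsInjectiveEnvelopeOfResidueField k E)
    (homFinite : ∀ A B : C, IsFiniteLength k (A ⟶ B)) : IsDualisingVariety k E C := by
  refine ⟨fun F => h.isFPCov_dualizeContra hE homFinite F.property, ?_⟩
  refine { faithful := ⟨fun {F F'} σ τ hστ => ?_⟩, full := ⟨fun {F F'} τ => ?_⟩,
           essSurj := ⟨fun G => ?_⟩ }
  · refine Quiver.Hom.unop_inj (ObjectProperty.hom_ext _ ?_)
    exact dualizeContra_map_injective hE (congrArg (fun f => f.hom) hστ)
  · obtain ⟨X, Y, p, ρ, hρ⟩ := (isFPContra_iff _).1 F.unop.property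
    obtain ⟨σ, hσ⟩ := exists_dualizeContra_map_eq hE
      (fun Z => hρ.isFiniteLength homFinite Z.unop) τ.hom
    exact ⟨Quiver.Hom.op (ObjectProperty.homMk σ), ObjectProperty.hom_ext _ hσ⟩
  · obtain ⟨X, Y, p, ρ, hρ⟩ := (isFPCov_iff _).1 G.property
    obtain ⟨e⟩ := nonempty_dualizeContra_dualizeCov_iso hE (hρ.isFiniteLength homFinite)
    exact ⟨op ⟨_, h.isFPContra_dualizeCov hE G.property⟩, ⟨ObjectProperty.isoMk _ e⟩⟩

end DualPresentation

/-- Theorem `th:main`.  For a `k`-linear Hom-finite essentially small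
idempotent complete triangulated category `C`, the following are equivalent:
(1) `C` admits a Serre functor; (2) `C` is a dualising `k`-variety; (3) `C` has right
determined morphisms. -/
theorem stmt_16 {k : Type v} [CommRing k] [IsArtinianRing k]
    (E : Type v) [AddCommGroup E] [Module k E]
    (hE : IsInjectiveEnvelopeOfResidueField k E)
    {C : Type u} [Category.{v} C] [Preadditive C] [Linear k C]
    [HasZeroObject C] [HasShift C ℤ] [∀ n : ℤ, (shiftFunctor C n).Additive]
    [Pretriangulated C] [IsTriangulated C]
    [EssentiallySmall.{v} C] [IsIdempotentComplete C]
    (homFinite : ∀ A B : C, IsFiniteLength k (A ⟶ B)) :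
    (HasSerreFunctor k E C ↔ IsDualisingVariety k E C) ∧
    (IsDualisingVariety k E C ↔ HasRightDeterminedMorphisms C) := by
  refine ⟨⟨fun h => h.isDualisingVariety hE homFinite, fun h => h.hasSerreFunctor hE homFinite⟩,
    ⟨fun h => (h.hasSerreFunctor hE homFinite).hasRightDeterminedMorphisms hE homFinite,
      fun h => (h.hasSerreFunctor hE homFinite).isDualisingVariety hE homFinite⟩⟩
end

section
/- Let C be an essentially small additive category and D a full additive subcategory. For a morphism α : X → Y in C the following are equivalent: (1) α is right determined by the class of objects of D; (2) for F = Coker Hom_C(−, α) in Mod C, the unit morphism F → coind_D(res_D F) of the adjunction is a monomorphism; (3) there exist some I ∈ Mod D and an exact sequence Hom_C(−, X) → Hom_C(−, Y) → coind_D(I) in Mod C, where the first map is composition with α. -/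
open CategoryTheory CategoryTheory.Limits Opposite

universe v u

/-- A morphism `α : X ⟶ Y` is right determined by a class `S` of objects if for every
`α' : X' ⟶ Y`, `α'` factors through `α` iff for every `φ : c ⟶ X'` with `c ∈ S` the
composite `φ ≫ α'` factors through `α`. -/
def RightDeterminedBySet {C : Type*} [Category C] {X Y : C} (α : X ⟶ Y) (S : Set C) : Prop :=
  ∀ ⦃X' : C⦄ (α' : X' ⟶ Y),
    FactorsThru α' α ↔ ∀ ⦃c : C⦄, c ∈ S → ∀ φ : c ⟶ X', FactorsThru (φ ≫ α') α

attribute [local instance] CategoryTheory.Limits.hasBinaryBiproducts_of_finite_biproducts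

variable {C : Type u} [SmallCategory C] [Preadditive C] [HasFiniteBiproducts C]

/-- The restriction functor `res_D : Mod C ⥤ Mod D` for the full (additive) subcategory `D`
of `C` determined by `P`, where `Mod C` is the category of additive functors `Cᵒᵖ ⥤ Ab`. -/
noncomputable def resD (P : C → Prop) :
    (Cᵒᵖ ⥤ AddCommGrpCat.{u}) ⥤ ((ObjectProperty.FullSubcategory P)ᵒᵖ ⥤ AddCommGrpCat.{u}) :=
  (Functor.whiskeringLeft _ _ _).obj (ObjectProperty.ι P).op

/-- The coinduction functor `coind_D : Mod D ⥤ Mod C`, the right adjoint of `res_D`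
(a right Kan extension). -/
noncomputable def coindD (P : C → Prop) :
    ((ObjectProperty.FullSubcategory P)ᵒᵖ ⥤ AddCommGrpCat.{u}) ⥤ (Cᵒᵖ ⥤ AddCommGrpCat.{u}) :=
  ((ObjectProperty.ι P).op).ran

/-- The adjunction `res_D ⊣ coind_D`. -/
noncomputable def resCoindAdj (P : C → Prop) : resD P ⊣ coindD P :=
  Functor.ranAdjunction _ _

/-- An element of a coinduced functor is zero as soon as its restrictions to the objects of the
subcategory are zero. -/
lemma coindD_eq_zero (P : C → Prop)
    (I : (ObjectProperty.FullSubcategory P)ᵒᵖ ⥤ AddCommGrpCat.{u}) {A : C}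
    (x : ((coindD P).obj I).obj (op A))
    (h : ∀ ⦃c : C⦄, P c → ∀ φ : c ⟶ A, ((coindD P).obj I).map φ.op x = 0) : x = 0 := by
  let E := Functor.RightExtension.mk _ ((ObjectProperty.ι P).op.ranCounit.app I)
  refine Concrete.isLimit_ext _
    (Functor.isPointwiseRightKanExtensionRanCounit (ObjectProperty.ι P).op I (op A)) x 0 fun f => ?_
  have key : ((coindD P).obj I).map f.hom x = 0 := h f.right.unop.property f.hom.unop
  exact ((congrArg (E.hom.app f.right).hom key).trans (map_zero (E.hom.app f.right).hom)).trans
    (map_zero ((E.coneAt (op A)).π.app f).hom).symm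

/-- On objects of the subcategory, the unit of the adjunction is injective. -/
lemma resCoindAdj_unit_app_app_injective (P : C → Prop) (F : Cᵒᵖ ⥤ AddCommGrpCat.{u})
    {c : C} (hc : P c) :
    Function.Injective (((resCoindAdj P).unit.app F).app (op c)) := by
  have h := (ObjectProperty.ι P).op.ranCounit_app_app_ranAdjunction_unit_app_app F (op ⟨c, hc⟩)
  have : Mono (((resCoindAdj P).unit.app F).app (op c)) :=
    (SplitMono.mk _ h).mono
  exact (AddCommGrpCat.mono_iff_injective _).1 this

/-- The unit of the adjunction is a monomorphism iff elements are detected by restriction to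
the objects of the subcategory. -/
lemma mono_resCoindAdj_unit_app_iff (P : C → Prop) (F : Cᵒᵖ ⥤ AddCommGrpCat.{u}) :
    Mono ((resCoindAdj P).unit.app F) ↔
      ∀ ⦃A : C⦄ (x : F.obj (op A)),
        (∀ ⦃c : C⦄, P c → ∀ φ : c ⟶ A, F.map φ.op x = 0) → x = 0 := by
  rw [NatTrans.mono_iff_mono_app]
  have nat : ∀ {A c : C} (φ : c ⟶ A) (x : F.obj (op A)),
      ((resCoindAdj P).unit.app F).app (op c) (F.map φ.op x) =
        ((coindD P).obj ((resD P).obj F)).map φ.op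
          (((resCoindAdj P).unit.app F).app (op A) x) := fun φ x =>
    NatTrans.naturality_apply ((resCoindAdj P).unit.app F) φ.op x
  constructor
  · intro hmono A x hx
    apply (AddCommGrpCat.mono_iff_injective _).1 (hmono (op A))
    rw [map_zero]
    refine coindD_eq_zero P _ _ fun c hc φ => ?_
    exact (nat φ x).symm.trans (by rw [hx hc φ, map_zero])
  · intro h A
    rw [AddCommGrpCat.mono_iff_injective]
    refine (injective_iff_map_eq_zero
      (((resCoindAdj P).unit.app F).app A).hom).2 fun x hx => ?_
    refine h (A := A.unop) x fun c hc φ => ?_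
    apply resCoindAdj_unit_app_app_injective P F hc
    rw [map_zero]
    exact (nat φ x).trans ((congrArg _ hx).trans (map_zero (AddCommGrpCat.Hom.hom _)))

/-- A morphism vanishes in the cokernel of `Hom(-, α)` iff it factors through `α`. -/
lemma cokernel_preadditiveYoneda_π_eq_zero_iff {E : Type u} [SmallCategory E] [Preadditive E]
    {X Y : E} (α : X ⟶ Y) {A : E} (g : A ⟶ Y) :
    (cokernel.π (preadditiveYoneda.map α)).app (op A) g = 0 ↔ FactorsThru g α := by
  have h := (ShortComplex.exact_cokernel (preadditiveYoneda.map α)).map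
    ((evaluation Eᵒᵖ AddCommGrpCat.{u}).obj (op A))
  rw [ShortComplex.ab_exact_iff_function_exact] at h
  exact h g

lemma cokernel_preadditiveYoneda_π_surjective {E : Type u} [SmallCategory E] [Preadditive E]
    {X Y : E} (α : X ⟶ Y) (A : E) :
    Function.Surjective ((cokernel.π (preadditiveYoneda.map α)).app (op A)) :=
  (AddCommGrpCat.epi_iff_surjective _).1 inferInstance

/-- Right determination in terms of the unit of the adjunction. -/
lemma rightDeterminedBySet_iff_mono_unit (P : C → Prop) {X Y : C} (α : X ⟶ Y) :
    RightDeterminedBySet α {c | P c} ↔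
      Mono ((resCoindAdj P).unit.app (cokernel (preadditiveYoneda.map α))) := by
  rw [mono_resCoindAdj_unit_app_iff]
  have nat : ∀ {A c : C} (φ : c ⟶ A) (g : A ⟶ Y),
      (cokernel.π (preadditiveYoneda.map α)).app (op c) (φ ≫ g) =
        (cokernel (preadditiveYoneda.map α)).map φ.op
          ((cokernel.π (preadditiveYoneda.map α)).app (op A) g) := fun φ g =>
    NatTrans.naturality_apply (cokernel.π (preadditiveYoneda.map α)) φ.op g
  constructor
  · intro h A x hx
    obtain ⟨g, rfl⟩ := cokernel_preadditiveYoneda_π_surjective α A x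
    refine (cokernel_preadditiveYoneda_π_eq_zero_iff α g).2 ((h g).2 fun c hc φ => ?_)
    exact (cokernel_preadditiveYoneda_π_eq_zero_iff α _).1 ((nat φ g).trans (hx hc φ))
  · intro h A g
    refine ⟨fun ⟨ψ, hψ⟩ c _ φ => ⟨φ ≫ ψ, by rw [Category.assoc, hψ]⟩, fun hg => ?_⟩
    refine (cokernel_preadditiveYoneda_π_eq_zero_iff α g).1 (h _ fun c hc φ => ?_)
    exact (nat φ g).symm.trans ((cokernel_preadditiveYoneda_π_eq_zero_iff α _).2 (hg hc φ))

/-- If `Hom(-, X) → Hom(-, Y) → coind_D I` is exact, then `α` is right determined by `D`. -/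
lemma rightDeterminedBySet_of_exact (P : C → Prop) {X Y : C} (α : X ⟶ Y)
    (I : (ObjectProperty.FullSubcategory P)ᵒᵖ ⥤ AddCommGrpCat.{u})
    (η : preadditiveYoneda.obj Y ⟶ (coindD P).obj I)
    (hη : ∀ A : C, Function.Exact (fun f : A ⟶ X => f ≫ α)
      (fun g : A ⟶ Y => (η.app (op A)) g)) :
    RightDeterminedBySet α {c | P c} := by
  intro A g
  refine ⟨fun ⟨ψ, hψ⟩ c _ φ => ⟨φ ≫ ψ, by rw [Category.assoc, hψ]⟩, fun hg => ?_⟩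
  refine (hη A g).1 (coindD_eq_zero P I _ fun c hc φ => ?_)
  exact (NatTrans.naturality_apply η φ.op g).symm.trans ((hη c (φ ≫ g)).2 (hg hc φ))

/-- Let `C` be an essentially small additive category and `D` the full
additive subcategory on the objects satisfying `P`.  For a morphism `α : X ⟶ Y` of `C` the
following are equivalent: (1) `α` is right determined by the class of objects of `D`;
(2) for `F = Coker Hom_C(−, α)`, the unit `F ⟶ coind_D (res_D F)` is a monomorphism;
(3) there are `I ∈ Mod D` and an exact sequence `Hom_C(−, X) → Hom_C(−, Y) → coind_D I`
(first map composition with `α`, exactness checked objectwise). -/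
theorem stmt_18 (P : C → Prop)
    (hP0 : ∀ Z : C, IsZero Z → P Z)
    (hPadd : ∀ A B : C, P A → P B → P (A ⊞ B))
    {X Y : C} (α : X ⟶ Y) :
    (RightDeterminedBySet α {c | P c} ↔
      Mono ((resCoindAdj P).unit.app (Limits.cokernel (preadditiveYoneda.map α)))) ∧
    (Mono ((resCoindAdj P).unit.app (Limits.cokernel (preadditiveYoneda.map α))) ↔
      ∃ (I : (ObjectProperty.FullSubcategory P)ᵒᵖ ⥤ AddCommGrpCat.{u})
        (η : preadditiveYoneda.obj Y ⟶ (coindD P).obj I),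
        ∀ A : C,
          Function.Exact (fun f : A ⟶ X => f ≫ α)
            (fun g : A ⟶ Y => (η.app (op A)) g)) := by
  refine ⟨rightDeterminedBySet_iff_mono_unit P α, fun hmono => ?_, fun ⟨I, η, hη⟩ =>
    (rightDeterminedBySet_iff_mono_unit P α).1 (rightDeterminedBySet_of_exact P α I η hη)⟩
  refine ⟨_, cokernel.π (preadditiveYoneda.map α) ≫ (resCoindAdj P).unit.app _, fun A g => ?_⟩
  refine Iff.trans ?_ (cokernel_preadditiveYoneda_π_eq_zero_iff α g)
  have hinj := (AddCommGrpCat.mono_iff_injective _).1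
    ((NatTrans.mono_iff_mono_app _).1 hmono (op A))
  exact map_eq_zero_iff (AddCommGrpCat.Hom.hom _) hinj
end
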